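/- Let λ = (λ_1, …, λ_n) be a partition. The Ferrers ideal I_λ is sequentially Cohen-Macaulay if and only if λ is saturated. -/

import Mathlib

open CategoryTheory CategoryTheory.Limits MvPolynomial

noncomputable section

namespace SkewTab

/-! ### Partitions and skew shapes (0-indexed) -/

/-- `lam` is a partition with exactly `n` positive parts (0-indexed),
extended by `0` beyond index `n - 1`. -/
def IsPartitionFn (n : ℕ) (lam : ℕ → ℕ) : Prop :=
  0 < n ∧ Antitone lam ∧ (∀ i, i < n → 0 < lam i) ∧ ∀ i, n ≤ i → lam i = 0

/-- `λ/μ` is a skew shape with `n` rows (0-indexed): `λ_i > μ_i ≥ 0` and `μ_n = 0`. -/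
def IsSkewShape (n : ℕ) (lam mu : ℕ → ℕ) : Prop :=
  0 < n ∧ Antitone lam ∧ Antitone mu ∧ (∀ i, i < n → mu i < lam i) ∧
    (∀ i, n ≤ i → lam i = 0) ∧ mu (n - 1) = 0

/-- The conjugate partition: `conj lam j = #{i : lam i > j}` (0-indexed). -/
def conj (lam : ℕ → ℕ) (j : ℕ) : ℕ := Nat.card {i | j < lam i}

/-- The set of boxes of the skew diagram `λ/μ` (0-indexed `(row, column)` pairs). -/
def skewDiagram (lam mu : ℕ → ℕ) : Set (ℕ × ℕ) :=
  {p | mu p.1 ≤ p.2 ∧ p.2 < lam p.1}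

/-- The set of boxes of the Ferrers diagram of a partition. -/
def ferrers (nu : ℕ → ℕ) : Set (ℕ × ℕ) := {p | p.2 < nu p.1}

/-- The block of the Ferrers diagram of `nu` containing the box `p`:  blocks are the
rectangular regions cut out by the horizontal lines at the values of the conjugate
partition and the vertical lines at the values of the partition. -/
def blockOf (nu : ℕ → ℕ) (p : ℕ × ℕ) : Set (ℕ × ℕ) :=
  {q | q.2 < nu q.1 ∧ nu q.1 = nu p.1 ∧ conj nu q.2 = conj nu p.2}

/-- A box `(i,j)` of the diagram of `nu` lies in a *corner block* iff its block has no
block to its right nor below it. -/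
def InCornerBlock (nu : ℕ → ℕ) (i j : ℕ) : Prop :=
  j < nu i ∧ conj nu (nu i - 1) = conj nu j ∧ nu (conj nu j - 1) = nu i

/-- A partition is unmixed iff all its corner blocks are square
(height of the block = width of the block). -/
def IsUnmixedPartition (nu : ℕ → ℕ) : Prop :=
  (∃ n, IsPartitionFn n nu) ∧
    ∀ i j, InCornerBlock nu i j →
      conj nu (nu i - 1) - conj nu (nu i) = nu (conj nu j - 1) - nu (conj nu j)

/-- A partition all of whose corner blocks are single boxes (1 × 1):
the condition defining prime Cohen-Macaulay shapes. -/
def IsCMPartition (nu : ℕ → ℕ) : Prop :=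
  (∃ n, IsPartitionFn n nu) ∧
    ∀ i j, InCornerBlock nu i j →
      conj nu (nu i - 1) - conj nu (nu i) = 1 ∧ nu (conj nu j - 1) - nu (conj nu j) = 1

/-- A copy of (the diagram of) a partition `nu` placed in the plane.  If `upper = true`
it is placed rotated by 180° and anchored at the bottom-right position `(row, col)`
(an upper triangular shape, hugging the top-right); if `upper = false` it is placed as is,
translated by `(row, col)` (a lower triangular shape, hugging the bottom-left). -/
structure PlacedShape where
  nu : ℕ → ℕ
  row : ℕ
  col : ℕ
  upper : Bool

/-- The embedding of the abstract diagram of `B.nu` into the plane. -/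
def PlacedShape.emb (B : PlacedShape) : ℕ × ℕ → ℕ × ℕ := fun p =>
  if B.upper then (B.row - p.1, B.col - p.2) else (B.row + p.1, B.col + p.2)

/-- The set of boxes of a placed shape. -/
def PlacedShape.boxes (B : PlacedShape) : Set (ℕ × ℕ) := B.emb '' ferrers B.nu

/-- For an upper triangular placed shape the anchor must leave room for the whole
(rotated) diagram. -/
def PlacedShape.Valid (B : PlacedShape) : Prop :=
  B.upper = true → conj B.nu 0 ≤ B.row + 1 ∧ B.nu 0 ≤ B.col + 1

/-- The two extremal blocks (top-right and bottom-left corner blocks) of a placed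
shape, as subsets of the plane. -/
def PlacedShape.extremalBlocks (B : PlacedShape) : Set (Set (ℕ × ℕ)) :=
  {B.emb '' blockOf B.nu (0, B.nu 0 - 1), B.emb '' blockOf B.nu (conj B.nu 0 - 1, 0)}

/-- `D` decomposes as a union of prime shapes `B 0, …, B (t-1)` (each a placed copy of a
partition satisfying `P`), consecutive shapes being of alternating (upper/lower) type and
intersecting exactly in a common extremal block. -/
def IsPrimeDecomposition (P : (ℕ → ℕ) → Prop) (D : Set (ℕ × ℕ)) (t : ℕ)
    (B : ℕ → PlacedShape) : Prop :=
  0 < t ∧ (∀ k, k < t → P (B k).nu ∧ (B k).Valid) ∧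
    (⋃ k ∈ Set.Iio t, (B k).boxes) = D ∧
    (∀ k, k + 1 < t → (B k).upper ≠ (B (k + 1)).upper) ∧
    ∀ k, k + 1 < t →
      (B k).boxes ∩ (B (k + 1)).boxes ∈ (B k).extremalBlocks ∧
      (B k).boxes ∩ (B (k + 1)).boxes ∈ (B (k + 1)).extremalBlocks

/-- The filling `w` is weakly increasing along both rows and columns on the boxes of `S`. -/
def WeaklyIncreasingOn (w : ℕ → ℕ → ℕ) (S : Set (ℕ × ℕ)) : Prop :=
  (∀ i j, (i, j) ∈ S → (i, j + 1) ∈ S → w i j ≤ w i (j + 1)) ∧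
    ∀ i j, (i, j) ∈ S → (i + 1, j) ∈ S → w i j ≤ w (i + 1) j

/-- The filling `w` is weakly decreasing along both rows and columns on the boxes of `S`. -/
def WeaklyDecreasingOn (w : ℕ → ℕ → ℕ) (S : Set (ℕ × ℕ)) : Prop :=
  (∀ i j, (i, j) ∈ S → (i, j + 1) ∈ S → w i (j + 1) ≤ w i j) ∧
    ∀ i j, (i, j) ∈ S → (i + 1, j) ∈ S → w (i + 1) j ≤ w i j

/-! ### Ideals and graphs attached to skew shapes -/

/-- The skew Ferrers ideal `I_{λ/μ}` in `k[x_1,…,x_n,y_1,…,y_m]`, `m = λ_1`. -/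
def skewIdeal (k : Type) [Field k] (n : ℕ) (lam mu : ℕ → ℕ) :
    Ideal (MvPolynomial (Fin n ⊕ Fin (lam 0)) k) :=
  Ideal.span {q | ∃ (i : Fin n) (j : Fin (lam 0)),
    mu (i : ℕ) ≤ (j : ℕ) ∧ (j : ℕ) < lam (i : ℕ) ∧ q = X (Sum.inl i) * X (Sum.inr j)}

/-- The skew tableau ideal `I(Y)` of the filling `w` of the skew shape `λ/μ`. -/
def tableauIdeal (k : Type) [Field k] (n : ℕ) (lam mu : ℕ → ℕ) (w : ℕ → ℕ → ℕ) :
    Ideal (MvPolynomial (Fin n ⊕ Fin (lam 0)) k) :=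
  Ideal.span {q | ∃ (i : Fin n) (j : Fin (lam 0)),
    mu (i : ℕ) ≤ (j : ℕ) ∧ (j : ℕ) < lam (i : ℕ) ∧
      q = (X (Sum.inl i) * X (Sum.inr j)) ^ w (i : ℕ) (j : ℕ)}

/-- The skew tableau ideal of the skew tableau obtained from `Y` by keeping only the rows
in `Rs` and the columns in `Cs`. -/
def tableauIdealRC (k : Type) [Field k] (n m : ℕ) (lam mu : ℕ → ℕ) (w : ℕ → ℕ → ℕ)
    (Rs : Set (Fin n)) (Cs : Set (Fin m)) : Ideal (MvPolynomial (↥Rs ⊕ ↥Cs) k) :=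
  Ideal.span {q | ∃ (i : ↥Rs) (j : ↥Cs),
    mu (i.1 : ℕ) ≤ (j.1 : ℕ) ∧ (j.1 : ℕ) < lam (i.1 : ℕ) ∧
      q = (X (Sum.inl i) * X (Sum.inr j)) ^ w (i.1 : ℕ) (j.1 : ℕ)}

/-- The skew Ferrers graph `G_{λ/μ}`, a bipartite graph on `{x_1,…,x_n} ⊔ {y_1,…,y_m}`. -/
def skewGraph (n : ℕ) (lam mu : ℕ → ℕ) : SimpleGraph (Fin n ⊕ Fin (lam 0)) :=
  SimpleGraph.fromRel fun a b => ∃ (i : Fin n) (j : Fin (lam 0)),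
    mu (i : ℕ) ≤ (j : ℕ) ∧ (j : ℕ) < lam (i : ℕ) ∧ a = Sum.inl i ∧ b = Sum.inr j

/-- The edge ideal of a simple graph. -/
def edgeIdeal (k : Type) [Field k] {V : Type} (G : SimpleGraph V) :
    Ideal (MvPolynomial V k) :=
  Ideal.span {q | ∃ u v, G.Adj u v ∧ q = X u * X v}

/-- The edge ideal of an edge-weighted simple graph. -/
def edgeIdealW (k : Type) [Field k] {V : Type} (G : SimpleGraph V) (w : V → V → ℕ) :
    Ideal (MvPolynomial V k) :=
  Ideal.span {q | ∃ u v, G.Adj u v ∧ q = (X u * X v) ^ w u v}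

/-! ### Homological notions -/

/-- The homogeneous maximal ideal of a polynomial ring. -/
def maxIdeal (k : Type) [Field k] (σ : Type) : Ideal (MvPolynomial σ k) :=
  Ideal.span (Set.range (X : σ → MvPolynomial σ k))

/-- The `i`-th local cohomology of the `R`-module `M` supported at the ideal `J`. -/
def localCoh {R : Type} [CommRing R] (J : Ideal R) (i : ℕ) (M : Type) [AddCommGroup M]
    [Module R M] : ModuleCat R :=
  (localCohomology J i).obj (ModuleCat.of R M)

/-- The Krull dimension of a module, `dim (R / ann M)`. -/
def moduleDim (R : Type) [CommRing R] (M : Type) [AddCommGroup M] [Module R M] :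
    WithBot ℕ∞ :=
  ringKrullDim (R ⧸ Module.annihilator R M)

/-- A module `M` is Cohen-Macaulay (w.r.t. the maximal ideal `J`) if
`H^i_J(M) = 0` for all `i < dim M`. -/
def IsCMModule {R : Type} [CommRing R] (J : Ideal R) (M : Type) [AddCommGroup M]
    [Module R M] : Prop :=
  ∀ i : ℕ, (i : WithBot ℕ∞) < moduleDim R M → IsZero (localCoh J i M)

/-- An ideal `I` is Cohen-Macaulay if `H^i_J(R/I) = 0` for all `i < dim R/I`
(`J` the maximal ideal). -/
def IsCMIdeal {R : Type} [CommRing R] (J I : Ideal R) : Prop :=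
  ∀ i : ℕ, (i : WithBot ℕ∞) < ringKrullDim (R ⧸ I) → IsZero (localCoh J i (R ⧸ I))

/-- An ideal `I` is generalized Cohen-Macaulay if `H^i_J(R/I)` has finite length for
all `i < dim R/I`. -/
def IsGCMIdeal {R : Type} [CommRing R] (J I : Ideal R) : Prop :=
  ∀ i : ℕ, (i : WithBot ℕ∞) < ringKrullDim (R ⧸ I) → IsFiniteLength R (localCoh J i (R ⧸ I))

/-- The canonical map `Ext^i(R/J, M) → H^i_J(M)`, i.e. the structure map of the colimit
defining local cohomology, at the first power of `J`. -/
def extToLocalCoh {R : Type} [CommRing R] (J : Ideal R) (i : ℕ) (M : ModuleCat R) :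
    ((localCohomology.diagram (localCohomology.idealPowersDiagram J) i).obj
        (Opposite.op (Opposite.op (1 : ℕ)))).obj M ⟶ (localCohomology J i).obj M :=
  have := localCohomology.hasColimitDiagram (localCohomology.idealPowersDiagram J) i
  (colimit.ι (localCohomology.diagram (localCohomology.idealPowersDiagram J) i)
    (Opposite.op (Opposite.op (1 : ℕ)))).app M

/-- An ideal `I` is Buchsbaum if the canonical map `Ext^i(R/J, R/I) → H^i_J(R/I)` is
surjective for all `i < dim R/I` (`J` the maximal ideal). -/
def IsBuchsbaumIdeal {R : Type} [CommRing R] (J I : Ideal R) : Prop :=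
  ∀ i : ℕ, (i : WithBot ℕ∞) < ringKrullDim (R ⧸ I) →
    Function.Surjective (extToLocalCoh J i (ModuleCat.of R (R ⧸ I)))

/-- An ideal `I` is unmixed if `dim R/P = dim R/I` for all associated primes `P` of `R/I`. -/
def IsUnmixedIdeal {R : Type} [CommRing R] (I : Ideal R) : Prop :=
  ∀ P ∈ associatedPrimes R (R ⧸ I), ringKrullDim (R ⧸ P) = ringKrullDim (R ⧸ I)

/-- A submodule of `S/J` (`S` a polynomial ring) is graded if it is the image of a
homogeneous ideal of `S`. -/
def IsGradedSubmodule (k σ : Type) [Field k] (J : Ideal (MvPolynomial σ k))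
    (N : Submodule (MvPolynomial σ k) (MvPolynomial σ k ⧸ J)) : Prop :=
  letI := MvPolynomial.gradedAlgebra (σ := σ) (R := k)
  ∃ K : Ideal (MvPolynomial σ k), Ideal.IsHomogeneous (homogeneousSubmodule σ k) K ∧
    ∀ x, x ∈ N ↔ x ∈ K.map (Ideal.Quotient.mk J)

/-- A (homogeneous) ideal `J` of a polynomial ring `S` is sequentially Cohen-Macaulay if
`S/J` admits a filtration `0 = M_0 ⊂ M_1 ⊂ ⋯ ⊂ M_r = S/J` by graded submodules such that
every quotient `M_{i+1}/M_i` is Cohen-Macaulay and the dimensions of the quotients are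
strictly increasing. -/
def IsSCMIdeal (k σ : Type) [Field k] (J : Ideal (MvPolynomial σ k)) : Prop :=
  ∃ (r : ℕ) (M : ℕ → Submodule (MvPolynomial σ k) (MvPolynomial σ k ⧸ J)),
    M 0 = ⊥ ∧ M r = ⊤ ∧ (∀ i, i < r → M i < M (i + 1)) ∧
    (∀ i, i ≤ r → IsGradedSubmodule k σ J (M i)) ∧
    (∀ i, i < r → IsCMModule (maxIdeal k σ)
      (↥(M (i + 1)) ⧸ Submodule.comap (M (i + 1)).subtype (M i))) ∧
    ∀ i, i + 2 ≤ r →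
      moduleDim (MvPolynomial σ k)
          (↥(M (i + 1)) ⧸ Submodule.comap (M (i + 1)).subtype (M i)) <
        moduleDim (MvPolynomial σ k)
          (↥(M (i + 2)) ⧸ Submodule.comap (M (i + 2)).subtype (M (i + 1)))

/-- A graph is sequentially Cohen-Macaulay if its edge ideal is. -/
def IsSCMGraph (k : Type) [Field k] {V : Type} (G : SimpleGraph V) : Prop :=
  IsSCMIdeal k V (edgeIdeal k G)

/-! ### Monomial ideals -/

/-- A monomial of a polynomial ring. -/
def IsMonomial {k σ : Type} [Field k] (u : MvPolynomial σ k) : Prop :=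
  ∃ d : σ →₀ ℕ, u = monomial d 1

/-- A monomial ideal of a polynomial ring. -/
def IsMonomialIdeal {k σ : Type} [Field k] (I : Ideal (MvPolynomial σ k)) : Prop :=
  ∃ T : Set (σ →₀ ℕ), I = Ideal.span ((fun d => (monomial d (1 : k) : MvPolynomial σ k)) '' T)

/-! ### Saturated partitions -/

/-- A partition is saturated if it is either strictly decreasing, or
`{λ_i, λ_i - 1, …, 1} ⊆ {λ_1, …, λ_n}` where `i` is the smallest index with
`λ_i = λ_{i+1}` (0-indexed here). -/
def IsSaturated (n : ℕ) (lam : ℕ → ℕ) : Prop :=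
  StrictAntiOn lam (Set.Iio n) ∨
    ∃ i, i + 1 < n ∧ lam i = lam (i + 1) ∧ (∀ j, j < i → lam j ≠ lam (j + 1)) ∧
      ∀ v, 0 < v → v ≤ lam i → ∃ a, a < n ∧ lam a = v

/-! ### Vertex decomposability -/

/-- A set `T` of vertices is independent in `G`. -/
def IsIndepSet {V : Type} (G : SimpleGraph V) (T : Finset V) : Prop :=
  ∀ u ∈ T, ∀ v ∈ T, ¬G.Adj u v

open Classical in
/-- The induced subgraph of `G` on a finite vertex set `A` is vertex decomposable:
either it has no edges, or it has a shredding vertex `v`, i.e. a vertex such that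
`G \ v` and `G \ N[v]` are vertex decomposable and no independent set of `G \ N[v]`
is a maximal independent set of `G \ v`. -/
def IsVertexDecomposable {V : Type} (G : SimpleGraph V) : Finset V → Prop := fun A =>
  (∀ u ∈ A, ∀ v ∈ A, ¬G.Adj u v) ∨
    ∃ v, ∃ _ : v ∈ A,
      IsVertexDecomposable G (A.erase v) ∧
      IsVertexDecomposable G (A.filter fun u => u ≠ v ∧ ¬G.Adj v u) ∧
      ∀ T ⊆ A.filter fun u => u ≠ v ∧ ¬G.Adj v u, IsIndepSet G T →
        ¬(T ⊆ A.erase v ∧ IsIndepSet G T ∧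
            ∀ u ∈ A.erase v, u ∉ T → ∃ t ∈ T, G.Adj u t)
termination_by A => A.card
decreasing_by
  · exact Finset.card_erase_lt_of_mem ‹_›
  · exact Finset.card_lt_card (Finset.filter_ssubset.mpr ⟨v, ‹_›, by simp⟩)

section Bridge

variable {R : Type} [CommRing R]

/-- The element `f` of a complex of modules, written in the opposite category, is a cocycle
representing the homology class `e`. -/
def Represents {ι : Type*} {c : ComplexShape ι} (K : HomologicalComplex (ModuleCat.{0} R)ᵒᵖ c)
    (i : ι) (f : (K.X i).unop) (e : (K.homology i).unop) : Prop :=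
  ∃ z : (K.opcycles i).unop, (K.pOpcycles i).unop z = f ∧ (K.homologyι i).unop z = e

section

variable {ι : Type*} {c : ComplexShape ι} (K L : HomologicalComplex (ModuleCat.{0} R)ᵒᵖ c)

lemma pOpcycles_unop_injective (i : ι) : Function.Injective (K.pOpcycles i).unop :=
  (ModuleCat.mono_iff_injective _).1 inferInstance

lemma exists_represents (i j : ι) (e : (K.homology i).unop) :
    ∃ f, Represents K i f e ∧ (K.d j i).unop f = 0 := by
  have : Function.Surjective (K.homologyι i).unop :=
    (ModuleCat.epi_iff_surjective _).1 inferInstance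
  obtain ⟨z, hz⟩ := this e
  refine ⟨_, ⟨z, rfl, hz⟩, ?_⟩
  have h := congrArg Quiver.Hom.unop (K.d_pOpcycles j i)
  exact congrArg (fun t => t.hom z) h

lemma exists_represents_of_cocycle (i j : ι) (hj : c.prev i = j) (f : (K.X i).unop)
    (hf : (K.d j i).unop f = 0) : ∃ e, Represents K i f e := by
  have h : (ShortComplex.mk _ _ (K.d_pOpcycles j i)).Exact :=
    ShortComplex.exact_of_g_is_cokernel _ (K.opcyclesIsCokernel j i hj)
  have h2 := h.unop
  rw [ShortComplex.moduleCat_exact_iff] at h2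
  obtain ⟨z, hz⟩ := h2 f hf
  exact ⟨_, z, hz, rfl⟩

lemma Represents.eq_zero_iff {i j : ι} (hj : c.next i = j) {f : (K.X i).unop}
    {e : (K.homology i).unop} (h : Represents K i f e) :
    e = 0 ↔ ∃ g : (K.X j).unop, (K.d i j).unop g = f := by
  obtain ⟨z, rfl, rfl⟩ := h
  have hp : ∀ g, (K.pOpcycles i).unop ((K.fromOpcycles i j).unop g) = (K.d i j).unop g := by
    intro g
    have h := congrArg Quiver.Hom.unop (K.p_fromOpcycles i j)
    exact congrArg (fun t => t.hom g) h
  constructor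
  · intro h0
    have h : (ShortComplex.mk _ _ (K.homologyι_comp_fromOpcycles i j)).Exact :=
      ShortComplex.exact_of_f_is_kernel _ (K.homologyIsKernel i j hj)
    have h2 := h.unop
    rw [ShortComplex.moduleCat_exact_iff] at h2
    obtain ⟨g, hg⟩ := h2 z h0
    exact ⟨g, (hp g).symm.trans (congrArg _ hg)⟩
  · rintro ⟨g, hg⟩
    rw [← hp] at hg
    rw [← pOpcycles_unop_injective K i hg]
    have h := congrArg Quiver.Hom.unop (K.homologyι_comp_fromOpcycles i j)
    exact congrArg (fun t => t.hom g) h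

variable {K L} in
lemma Represents.map {i : ι} (φ : K ⟶ L) {f : (L.X i).unop} {e : (L.homology i).unop}
    (h : Represents L i f e) :
    Represents K i ((φ.f i).unop f) ((HomologicalComplex.homologyMap φ i).unop e) := by
  obtain ⟨z, rfl, rfl⟩ := h
  refine ⟨(HomologicalComplex.opcyclesMap φ i).unop z, ?_, ?_⟩
  · have h := congrArg Quiver.Hom.unop (HomologicalComplex.p_opcyclesMap φ i)
    exact congrArg (fun t => t.hom z) h
  · have h := congrArg Quiver.Hom.unop (HomologicalComplex.homologyι_naturality φ i)
    exact (congrArg (fun t => t.hom z) h).symm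

end

section

variable {X X' : ModuleCat.{0} R} (P : ProjectiveResolution X) (P' : ProjectiveResolution X')
  (Y : ModuleCat.{0} R) (n : ℕ)

/-- The complex `Hom(P, Y)`, in the opposite of the category of modules. -/
abbrev homComplexOp : ChainComplex (ModuleCat.{0} R)ᵒᵖ ℕ :=
  (((linearYoneda R (ModuleCat.{0} R)).obj Y).rightOp.mapHomologicalComplex _).obj P.complex

/-- A cocycle `f : P_n ⟶ Y` represents the class `e` in the derived functor `Ext`. -/
def RepresentsExt (f : P.complex.X n ⟶ Y)
    (e : ((Ext R (ModuleCat.{0} R) n).obj (Opposite.op X)).obj Y) : Prop :=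
  Represents (homComplexOp P Y) n f
    ((P.isoLeftDerivedObj ((linearYoneda R (ModuleCat.{0} R)).obj Y).rightOp n).inv.unop e)

variable {P P' Y n}

lemma exists_representsExt (e : ((Ext R (ModuleCat.{0} R) n).obj (Opposite.op X)).obj Y) :
    ∃ f, RepresentsExt P Y n f e ∧ P.complex.d (n + 1) n ≫ f = 0 :=
  exists_represents (homComplexOp P Y) n (n + 1) _

lemma exists_representsExt_of_cocycle (f : P.complex.X n ⟶ Y)
    (hf : P.complex.d (n + 1) n ≫ f = 0) : ∃ e, RepresentsExt P Y n f e := by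
  obtain ⟨e, he⟩ := exists_represents_of_cocycle (homComplexOp P Y) n (n + 1)
    (ChainComplex.prev ℕ n) f hf
  let i := P.isoLeftDerivedObj ((linearYoneda R (ModuleCat.{0} R)).obj Y).rightOp n
  refine ⟨i.hom.unop e, ?_⟩
  have h : i.hom.unop ≫ i.inv.unop = 𝟙 _ := by rw [← unop_comp, i.inv_hom_id]; rfl
  have h2 : i.inv.unop (i.hom.unop e) = e := congrArg (fun t => t.hom e) h
  unfold RepresentsExt
  erw [h2]
  exact he

lemma RepresentsExt.eq_zero_iff {m : ℕ} (hm : (ComplexShape.down ℕ).next n = m)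
    {f : P.complex.X n ⟶ Y} {e} (h : RepresentsExt P Y n f e) :
    e = 0 ↔ ∃ g : P.complex.X m ⟶ Y, P.complex.d n m ≫ g = f := by
  refine Iff.trans ?_ (Represents.eq_zero_iff (homComplexOp P Y) hm h)
  let i := P.isoLeftDerivedObj ((linearYoneda R (ModuleCat.{0} R)).obj Y).rightOp n
  have : Function.Injective i.inv.unop := (ModuleCat.mono_iff_injective _).1 inferInstance
  exact (map_eq_zero_iff i.inv.unop.hom this).symm

lemma RepresentsExt.map {g : X' ⟶ X} (φ : ProjectiveResolution.Hom P' P g)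
    {f : P.complex.X n ⟶ Y} {e} (h : RepresentsExt P Y n f e) :
    RepresentsExt P' Y n (φ.hom.f n ≫ f)
      ((((Ext R (ModuleCat.{0} R) n).map g.op).app Y) e) := by
  let F := ((linearYoneda R (ModuleCat.{0} R)).obj Y).rightOp
  have h1 := Represents.map ((F.mapHomologicalComplex _).map φ.hom) h
  have h2 := ProjectiveResolution.isoLeftDerivedObj_inv_naturality g P' P φ.hom
    φ.hom_f_zero_comp_π_f_zero F n
  have h3 := congrArg (fun t => t.unop.hom e) h2
  unfold RepresentsExt
  have h4 : (P'.isoLeftDerivedObj F n).inv.unop ((((Ext R (ModuleCat.{0} R) n).map g.op).app Y) e)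
    = (HomologicalComplex.homologyMap ((F.mapHomologicalComplex _).map φ.hom) n).unop
      ((P.isoLeftDerivedObj F n).inv.unop e) := h3
  erw [h4]
  exact h1

end

end Bridge

section Bridge

variable {R : Type} [CommRing R]

lemma extMk_eq_zero_iff_next {X Y : ModuleCat.{0} R} (P : ProjectiveResolution X) {n m : ℕ}
    (hm : (ComplexShape.down ℕ).next n = m) (f : P.complex.X n ⟶ Y)
    (hf : P.complex.d (n + 1) n ≫ f = 0) :
    P.extMk f (n + 1) rfl hf = 0 ↔ ∃ g : P.complex.X m ⟶ Y, P.complex.d n m ≫ g = f := by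
  cases n with
  | zero =>
    subst hm
    have h0 : P.complex.d 0 ((ComplexShape.down ℕ).next 0) = 0 := P.complex.shape _ _ (by simp)
    simp only [h0, zero_comp, exists_const_iff]
    constructor
    · intro h
      rw [← P.extEquivCohomologyClass.apply_eq_iff_eq, P.extEquivCohomologyClass_extMk,
        P.extEquivCohomologyClass_zero,
        CochainComplex.HomComplex.CohomologyClass.mk_eq_zero_iff,
        CochainComplex.HomComplex.Cocycle.toSingleMk_mem_coboundaries_iff _ _ _ _ _ 1 (by simp)]
        at h
      obtain ⟨g, hg⟩ := h
      have : IsZero (P.cochainComplex.X 1) := P.cochainComplex.isZero_of_isStrictlyLE 0 1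
      rw [this.eq_of_src g 0, comp_zero, eq_comm] at hg
      refine ⟨⟨0⟩, ?_⟩
      rw [← cancel_epi (P.cochainComplexXIso (-0) 0 rfl).hom]
      simpa using hg.symm
    · rintro ⟨-, rfl⟩
      simp
  | succ p =>
    obtain rfl : p = m := by simpa using hm
    exact P.extMk_eq_zero_iff f _ rfl hf p rfl

/-- The projection `R / J ^ s ⟶ R / J ^ t`, for `t ≤ s`. -/
def powProj (J : Ideal R) {t s : ℕ} (h : t ≤ s) :
    ModuleCat.of R (R ⧸ J ^ s) ⟶ ModuleCat.of R (R ⧸ J ^ t) :=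
  ModuleCat.ofHom (Submodule.mapQ _ _ LinearMap.id (Ideal.pow_le_pow_right h))

lemma isZero_localCohomology_iff (J : Ideal R) (i : ℕ) (M : ModuleCat.{0} R) :
    IsZero ((localCohomology J i).obj M) ↔
      ∀ (t : ℕ) (e : ((Ext R (ModuleCat.{0} R) i).obj
        (Opposite.op (ModuleCat.of R (R ⧸ J ^ t)))).obj M),
        ∃ (s : ℕ) (h : t ≤ s),
          (((Ext R (ModuleCat.{0} R) i).map (powProj J h).op).app M) e = 0 := by
  let D := localCohomology.diagram (localCohomology.idealPowersDiagram J) i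
  let G := D ⋙ (evaluation _ _).obj M
  let iso : (localCohomology J i).obj M ≅ colimit G :=
    colimitObjIsoColimitCompEvaluation D M
  rw [iso.isZero_iff, ModuleCat.isZero_iff_subsingleton]
  constructor
  · intro h t e
    have h0 : colimit.ι G (Opposite.op (Opposite.op t)) e = 0 := Subsingleton.elim _ _
    obtain ⟨j, φ, hφ⟩ := Concrete.colimit_rep_eq_zero (R := R) G _ _ h0
    exact ⟨j.unop.unop, leOfHom φ.unop.unop, hφ⟩
  · intro h
    refine ⟨fun a b => ?_⟩
    have key : ∀ a : ToType (colimit G), a = 0 := by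
      intro a
      obtain ⟨j, x, rfl⟩ := Concrete.colimit_exists_rep G a
      obtain ⟨s, hs, h0⟩ := h j.unop.unop x
      let φ : j ⟶ Opposite.op (Opposite.op s) := (homOfLE hs).op.op
      rw [← colimit.w G φ]
      exact (congrArg (colimit.ι G (Opposite.op (Opposite.op s))) h0).trans (map_zero _)
    exact (key a).trans (key b).symm

lemma isZero_localCoh_iff (J : Ideal R) (i : ℕ) (M : Type) [AddCommGroup M] [Module R M] :
    IsZero (localCoh J i M) ↔
      ∀ (t : ℕ) (e : Abelian.Ext (ModuleCat.of R (R ⧸ J ^ t)) (ModuleCat.of R M) i),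
        ∃ (s : ℕ) (h : t ≤ s), (Abelian.Ext.mk₀ (powProj J h)).comp e (zero_add _) = 0 := by
  let P (t : ℕ) : ProjectiveResolution (ModuleCat.of R (R ⧸ J ^ t)) := projectiveResolution _
  let φ {t s : ℕ} (h : t ≤ s) : ProjectiveResolution.Hom (P s) (P t) (powProj J h) :=
    { hom := ProjectiveResolution.lift (powProj J h) _ _
      hom_f_zero_comp_π_f_zero := by
        rw [ProjectiveResolution.lift_commutes_zero]; simp }
  refine (isZero_localCohomology_iff J i _).trans ⟨fun H t e => ?_, fun H t e => ?_⟩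
  · obtain ⟨f, hf, rfl⟩ := (P t).extMk_surjective e (i + 1) rfl
    obtain ⟨e', he'⟩ := exists_representsExt_of_cocycle f hf
    obtain ⟨s, h, h0⟩ := H t e'
    refine ⟨s, h, ?_⟩
    rw [ProjectiveResolution.mk₀_comp_extMk _ _ _ _ (φ h), extMk_eq_zero_iff_next (P s) rfl]
    exact ((he'.map (φ h)).eq_zero_iff rfl).1 h0
  · obtain ⟨f, hf, h1⟩ := exists_representsExt (P := P t) e
    obtain ⟨s, h, h0⟩ := H t ((P t).extMk f (i + 1) rfl h1)
    refine ⟨s, h, ?_⟩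
    rw [ProjectiveResolution.mk₀_comp_extMk _ _ _ _ (φ h), extMk_eq_zero_iff_next (P s) rfl] at h0
    exact ((hf.map (φ h)).eq_zero_iff rfl).2 h0

end Bridge

section Depth

open CategoryTheory.Abelian

variable {R : Type} [CommRing R] (J : Ideal R)

/-- An `Ext`-class out of `R / J ^ t` which dies on some `R / J ^ s`, `s ≥ t`, that is, whose
image in local cohomology vanishes. -/
def IsEventuallyZero {M : ModuleCat.{0} R} {i t : ℕ}
    (e : Ext (ModuleCat.of R (R ⧸ J ^ t)) M i) : Prop :=
  ∃ (s : ℕ) (h : t ≤ s), (Ext.mk₀ (powProj J h)).comp e (zero_add _) = 0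

variable {J}

lemma powProj_comp_powProj {t s r : ℕ} (h : t ≤ s) (h' : s ≤ r) :
    powProj J h' ≫ powProj J h = powProj J (h.trans h') := by
  ext
  rfl

section

variable {M : ModuleCat.{0} R} {i t : ℕ} {e : Ext (ModuleCat.of R (R ⧸ J ^ t)) M i}

lemma IsEventuallyZero.of_powProj {s : ℕ} (h : t ≤ s)
    (H : IsEventuallyZero J ((Ext.mk₀ (powProj J h)).comp e (zero_add _))) :
    IsEventuallyZero J e := by
  obtain ⟨r, hr, h0⟩ := H
  refine ⟨r, h.trans hr, ?_⟩
  rwa [Ext.mk₀_comp_mk₀_assoc, powProj_comp_powProj] at h0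

lemma IsEventuallyZero.comp {N : ModuleCat.{0} R} {j l : ℕ} (H : IsEventuallyZero J e)
    (f : Ext M N j) (hl : i + j = l) : IsEventuallyZero J (e.comp f hl) := by
  obtain ⟨s, h, h0⟩ := H
  refine ⟨s, h, ?_⟩
  rw [← Ext.comp_assoc _ _ _ (zero_add _) hl (by lia), h0, Ext.zero_comp]

lemma pow_smul_ext_eq_zero {x : R} (hx : x ∈ J) : x ^ t • e = 0 := by
  have h : x ^ t • 𝟙 (ModuleCat.of R (R ⧸ J ^ t)) = 0 := by
    ext
    simp only [ModuleCat.hom_smul, ModuleCat.hom_id, LinearMap.smul_apply, LinearMap.id_coe, id_eq,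
      ModuleCat.hom_zero, LinearMap.zero_apply, LinearMap.coe_comp, Function.comp_apply]
    have : Ideal.Quotient.mk (J ^ t) (x ^ t) = 0 :=
      Ideal.Quotient.eq_zero_iff_mem.2 (Ideal.pow_mem_pow hx t)
    simpa [Algebra.smul_def] using this
  rw [← Ext.mk₀_id_comp e, ← Ext.smul_comp, ← Ext.mk₀_smul, h, Ext.mk₀_zero, Ext.zero_comp]

end

section

variable {S : ShortComplex (ModuleCat.{0} R)} (hS : S.ShortExact) {i : ℕ}

include hS

lemma IsEventuallyZero.middle
    (h₁ : ∀ t (e : Ext (ModuleCat.of R (R ⧸ J ^ t)) S.X₁ i), IsEventuallyZero J e)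
    (h₃ : ∀ t (e : Ext (ModuleCat.of R (R ⧸ J ^ t)) S.X₃ i), IsEventuallyZero J e)
    (t : ℕ) (e : Ext (ModuleCat.of R (R ⧸ J ^ t)) S.X₂ i) : IsEventuallyZero J e := by
  obtain ⟨s, h, h0⟩ := h₃ t (e.comp (Ext.mk₀ S.g) (add_zero _))
  rw [← Ext.comp_assoc _ _ _ (zero_add _) (add_zero _) (by lia)] at h0
  obtain ⟨e', he'⟩ := Ext.covariant_sequence_exact₂ _ hS _ h0
  refine IsEventuallyZero.of_powProj h ?_
  rw [← he']
  exact (h₁ s e').comp _ _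

lemma IsEventuallyZero.left_succ
    (h₂ : ∀ t (e : Ext (ModuleCat.of R (R ⧸ J ^ t)) S.X₂ (i + 1)), IsEventuallyZero J e)
    (h₃ : ∀ t (e : Ext (ModuleCat.of R (R ⧸ J ^ t)) S.X₃ i), IsEventuallyZero J e)
    (t : ℕ) (e : Ext (ModuleCat.of R (R ⧸ J ^ t)) S.X₁ (i + 1)) : IsEventuallyZero J e := by
  obtain ⟨s, h, h0⟩ := h₂ t (e.comp (Ext.mk₀ S.f) (add_zero _))
  rw [← Ext.comp_assoc _ _ _ (zero_add _) (add_zero _) (by lia)] at h0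
  obtain ⟨e', he'⟩ := Ext.covariant_sequence_exact₁ _ hS _ h0 rfl
  refine IsEventuallyZero.of_powProj h ?_
  rw [← he']
  exact (h₃ s e').comp _ _

lemma IsEventuallyZero.left_zero
    (h₂ : ∀ t (e : Ext (ModuleCat.of R (R ⧸ J ^ t)) S.X₂ 0), IsEventuallyZero J e)
    (t : ℕ) (e : Ext (ModuleCat.of R (R ⧸ J ^ t)) S.X₁ 0) : IsEventuallyZero J e := by
  obtain ⟨s, h, h0⟩ := h₂ t (e.comp (Ext.mk₀ S.f) (add_zero _))
  rw [← Ext.comp_assoc _ _ _ (zero_add _) (add_zero _) (by lia)] at h0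
  have := hS.mono_f
  exact ⟨s, h, (injective_iff_map_eq_zero _).1 (Ext.postcomp_mk₀_injective_of_mono _ S.f) _ h0⟩

lemma IsEventuallyZero.right
    (h₂ : ∀ t (e : Ext (ModuleCat.of R (R ⧸ J ^ t)) S.X₂ i), IsEventuallyZero J e)
    (h₁ : ∀ t (e : Ext (ModuleCat.of R (R ⧸ J ^ t)) S.X₁ (i + 1)), IsEventuallyZero J e)
    (t : ℕ) (e : Ext (ModuleCat.of R (R ⧸ J ^ t)) S.X₃ i) : IsEventuallyZero J e := by
  obtain ⟨s, h, h0⟩ := h₁ t (e.comp hS.extClass rfl)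
  rw [← Ext.comp_assoc _ _ _ (zero_add _) rfl (by lia)] at h0
  obtain ⟨e', he'⟩ := Ext.covariant_sequence_exact₃ _ hS _ rfl h0
  refine IsEventuallyZero.of_powProj h ?_
  rw [← he']
  exact (h₂ s e').comp _ _

end

variable (J) in
/-- The `J`-depth of the module `M` is at least `d`. -/
def DepthGE (d : ℕ) (M : Type) [AddCommGroup M] [Module R M] : Prop :=
  ∀ i, i < d → IsZero (localCoh J i M)

variable {A B C : Type} [AddCommGroup A] [AddCommGroup B] [AddCommGroup C]
  [Module R A] [Module R B] [Module R C]

lemma depthGE_iff {d : ℕ} : DepthGE J d A ↔ ∀ i, i < d →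
    ∀ t (e : Ext (ModuleCat.of R (R ⧸ J ^ t)) (ModuleCat.of R A) i), IsEventuallyZero J e :=
  forall₂_congr fun i _ => isZero_localCoh_iff J i A

lemma DepthGE.mono {d d' : ℕ} (h : DepthGE J d A) (hd : d' ≤ d) : DepthGE J d' A :=
  fun i hi => h i (hi.trans_le hd)

lemma depthGE_zero : DepthGE J 0 A := fun _ hi => absurd hi (Nat.not_lt_zero _)

lemma DepthGE.of_equiv {d : ℕ} (h : DepthGE J d A) (e : A ≃ₗ[R] B) : DepthGE J d B :=
  fun i hi => (h i hi).of_iso ((localCohomology J i).mapIso e.symm.toModuleIso)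

section

variable {f : A →ₗ[R] B} {g : B →ₗ[R] C} (hf : Function.Injective f)
  (hg : Function.Surjective g) (hfg : Function.Exact f g)

include hf hg hfg

lemma exists_shortExact : ∃ S : ShortComplex (ModuleCat.{0} R), S.ShortExact ∧
    S.X₁ = ModuleCat.of R A ∧ S.X₂ = ModuleCat.of R B ∧ S.X₃ = ModuleCat.of R C := by
  refine ⟨ModuleCat.shortComplexOfCompEqZero f g hfg.linearMap_comp_eq_zero, ?_, rfl, rfl, rfl⟩
  have : Mono (ModuleCat.ofHom f) := (ModuleCat.mono_iff_injective _).2 hf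
  have : Epi (ModuleCat.ofHom g) := (ModuleCat.epi_iff_surjective _).2 hg
  exact { exact := ModuleCat.shortComplex_exact _ hfg }

lemma DepthGE.middle {d : ℕ} (hA : DepthGE J d A) (hC : DepthGE J d C) : DepthGE J d B := by
  obtain ⟨S, hS, h₁, h₂, h₃⟩ := exists_shortExact hf hg hfg
  rw [depthGE_iff] at *
  rw [← h₁] at hA
  rw [← h₂]
  rw [← h₃] at hC
  exact fun i hi => IsEventuallyZero.middle hS (hA i hi) (hC i hi)

lemma DepthGE.left {d : ℕ} (hB : DepthGE J (d + 1) B) (hC : DepthGE J d C) :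
    DepthGE J (d + 1) A := by
  obtain ⟨S, hS, h₁, h₂, h₃⟩ := exists_shortExact hf hg hfg
  rw [depthGE_iff] at *
  rw [← h₁]
  rw [← h₂] at hB
  rw [← h₃] at hC
  intro i hi
  cases i with
  | zero => exact IsEventuallyZero.left_zero hS (hB 0 hi)
  | succ i => exact IsEventuallyZero.left_succ hS (hB _ hi) (hC i (by lia))

lemma DepthGE.right {d : ℕ} (hB : DepthGE J d B) (hA : DepthGE J (d + 1) A) : DepthGE J d C := by
  obtain ⟨S, hS, h₁, h₂, h₃⟩ := exists_shortExact hf hg hfg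
  rw [depthGE_iff] at *
  rw [← h₁] at hA
  rw [← h₂] at hB
  rw [← h₃]
  exact fun i hi => IsEventuallyZero.right hS (hB i hi) (hA _ (by lia))

end

lemma DepthGE.of_subsingleton [Subsingleton A] (d : ℕ) : DepthGE J d A := by
  rw [depthGE_iff]
  intro i _ t e
  refine ⟨t, le_rfl, ?_⟩
  have : IsZero (ModuleCat.of R A) := ModuleCat.isZero_of_subsingleton _
  rw [← Ext.comp_mk₀_id e, this.eq_of_src (𝟙 _) 0, Ext.mk₀_zero, Ext.comp_zero, Ext.comp_zero]

lemma DepthGE.succ_of_regular {x : R} (hx : x ∈ J) {g : B →ₗ[R] C}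
    (hf : Function.Injective (LinearMap.lsmul R B x)) (hg : Function.Surjective g)
    (hfg : Function.Exact (LinearMap.lsmul R B x) g) {d : ℕ} (hC : DepthGE J d C) :
    DepthGE J (d + 1) B := by
  let S := ModuleCat.shortComplexOfCompEqZero _ g hfg.linearMap_comp_eq_zero
  have : Mono (ModuleCat.ofHom (LinearMap.lsmul R B x)) := (ModuleCat.mono_iff_injective _).2 hf
  have : Epi (ModuleCat.ofHom g) := (ModuleCat.epi_iff_surjective _).2 hg
  have hS : S.ShortExact := { exact := ModuleCat.shortComplex_exact _ hfg }
  have hSf : S.f = x • 𝟙 (ModuleCat.of R B) := rfl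
  rw [depthGE_iff] at *
  have key : ∀ i < d + 1, ∀ t (e : Ext (ModuleCat.of R (R ⧸ J ^ t)) (ModuleCat.of R B) i),
      x • e = 0 → IsEventuallyZero J e := by
    intro i hi t e he
    rw [Ext.smul_eq_comp_mk₀, ← hSf] at he
    cases i with
    | zero =>
      refine ⟨t, le_rfl, ?_⟩
      have h0 : e = 0 :=
        (injective_iff_map_eq_zero _).1 (Ext.postcomp_mk₀_injective_of_mono _ S.f) _ he
      rw [h0, Ext.comp_zero]
    | succ i =>
      obtain ⟨e', rfl⟩ := Ext.covariant_sequence_exact₁ _ hS e he rfl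
      exact (hC i (by lia) t e').comp _ _
  have key2 : ∀ n : ℕ, ∀ i < d + 1,
      ∀ t (e : Ext (ModuleCat.of R (R ⧸ J ^ t)) (ModuleCat.of R B) i),
      x ^ n • e = 0 → IsEventuallyZero J e := by
    intro n
    induction n with
    | zero =>
      intro i hi t e he
      rw [pow_zero, one_smul] at he
      exact ⟨t, le_rfl, by rw [he, Ext.comp_zero]⟩
    | succ n ih =>
      intro i hi t e he
      rw [pow_succ', mul_smul] at he
      obtain ⟨s, h, h0⟩ := key i hi t _ he
      rw [Ext.comp_smul] at h0
      exact IsEventuallyZero.of_powProj h (ih i hi s _ h0)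
  exact fun i hi t e => key2 t i hi t e (pow_smul_ext_eq_zero hx)

lemma DepthGE.eq_zero_of_pow_smul {d : ℕ} (hd : 0 < d) (hA : DepthGE J d A) {z : A} {t : ℕ}
    (hz : ∀ r ∈ J ^ t, r • z = 0) : z = 0 := by
  rw [depthGE_iff] at hA
  let φ : (R ⧸ J ^ t) →ₗ[R] A := Submodule.liftQ _ (LinearMap.toSpanSingleton R A z) (by
    intro r hr
    simpa using hz r hr)
  obtain ⟨s, h, h0⟩ := hA 0 hd t (Ext.mk₀ (ModuleCat.ofHom φ))
  rw [Ext.mk₀_comp_mk₀] at h0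
  have h1 : powProj J h ≫ ModuleCat.ofHom φ = 0 := by
    rw [← Ext.mk₀_zero] at h0
    exact Ext.addEquiv₀.symm.injective h0
  have h2 := congrArg (fun t => t.hom (Submodule.Quotient.mk 1)) h1
  have h3 : (LinearMap.toSpanSingleton R A z) 1 = 0 := h2
  simpa using h3

end Depth

section DepthPrime

variable {R : Type} [CommRing R] [IsNoetherianRing R]

lemma exists_mem_forall_smul_ne_zero {M : Type} [AddCommGroup M] [Module R M] [Module.Finite R M]
    {m : Ideal R} [m.IsMaximal] (h : ∀ z : M, (∀ r ∈ m, r • z = 0) → z = 0) :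
    ∃ f ∈ m, ∀ z : M, f • z = 0 → z = 0 := by
  by_contra! H
  have hsub : (m : Set R) ⊆ ⋃ p ∈ associatedPrimes R M, (p : Set R) := by
    rw [biUnion_associatedPrimes_eq_zero_divisors]
    intro f hf
    obtain ⟨z, hz, hz0⟩ := H f hf
    exact ⟨z, hz0, hz⟩
  have hfin := associatedPrimes.finite R M
  have hsub' : (m : Set R) ⊆ ⋃ p ∈ (hfin.toFinset : Set (Ideal R)), (p : Set R) := by
    simpa using hsub
  obtain ⟨p, hp, hmp⟩ := (Ideal.subset_union_prime (f := fun p : Ideal R => p) ⊥ ⊥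
    (fun p hp _ _ => IsAssociatedPrime.isPrime (hfin.mem_toFinset.1 hp))).1 hsub'
  have hp' : IsAssociatedPrime p M := hfin.mem_toFinset.1 hp
  obtain rfl : m = p := Ideal.IsMaximal.eq_of_le ‹_› hp'.isPrime.ne_top hmp
  obtain ⟨hprime, x, hx⟩ := (isAssociatedPrime_iff (I := m) (M := M)).1 hp'
  have hx0 : x = 0 := h x fun r hr => by
    rw [hx, Submodule.mem_colon_singleton] at hr
    simpa using hr
  apply hprime.ne_top
  rw [hx, hx0, Ideal.eq_top_iff_one, Submodule.mem_colon_singleton]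
  simp

/-- Depth bounds the dimension of some prime above each local annihilator. -/
lemma DepthGE.exists_prime {m : Ideal R} [m.IsMaximal] {d : ℕ} :
    ∀ {M : Type} [AddCommGroup M] [Module R M] [Module.Finite R M], DepthGE m d M →
      ∀ z : M, (∀ r : R, r • z = 0 → r ∈ m) →
      ∃ p : Ideal R, p.IsPrime ∧ (∀ r : R, r • z = 0 → r ∈ p) ∧
        (d : WithBot ℕ∞) ≤ ringKrullDim (R ⧸ p) := by
  induction d with
  | zero =>
    intro M _ _ _ _ z hz
    refine ⟨m, inferInstance, hz, ?_⟩
    exact_mod_cast ringKrullDim_nonneg_of_nontrivial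
  | succ d ih =>
    intro M _ _ _ hM z hz
    obtain ⟨f, hfm, hf⟩ := exists_mem_forall_smul_ne_zero (m := m) (M := M) fun z hz =>
      hM.eq_zero_of_pow_smul (Nat.succ_pos d) (t := 1) (by simpa using hz)
    have hle : (⊥ : Submodule R M).colon {z} ≤ m := fun r hr => hz r (by
      simpa [Submodule.mem_colon_singleton] using hr)
    obtain ⟨p, hp, hpm⟩ := Ideal.exists_minimalPrimes_le hle
    have hpp : p.IsPrime := hp.1.1
    obtain ⟨w, hw⟩ := Submodule.exists_eq_colon_of_mem_minimalPrimes hp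
    have hw' : ∀ r : R, r ∈ p ↔ r • w = 0 := fun r => by
      rw [hw, Submodule.mem_colon_singleton, Submodule.mem_bot]
    have hfp : f ∉ p := fun h => hpp.ne_top (by
      rw [Ideal.eq_top_iff_one, hw', hf w ((hw' f).1 h), smul_zero])
    let N : Submodule R M := Submodule.torsionBySet R M p
    have hN : ∀ x : M, x ∈ N ↔ ∀ r ∈ p, r • x = 0 := fun x => by
      simp [N, Submodule.mem_torsionBySet_iff]
    have hwN : w ∈ N := (hN w).2 fun r hr => (hw' r).1 hr
    obtain ⟨u, huN, hu⟩ : ∃ u ∈ N, ∀ r : R, (∃ v : M, r • u = f • v) → r ∈ m := by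
      by_contra! H
      have hNm : N ≤ m • N := by
        intro u hu
        obtain ⟨r, ⟨v, hv⟩, hr⟩ := H u hu
        have hvN : v ∈ N := (hN v).2 fun s hs => hf _ (by
          rw [smul_comm, ← hv, smul_comm, (hN u).1 hu s hs, smul_zero])
        obtain ⟨a, ha⟩ := Ideal.IsMaximal.exists_inv ‹_› hr
        obtain ⟨b, hb, hab⟩ := ha
        have : u = b • u + f • (a • v) := by
          rw [smul_comm f a v, ← hv, smul_smul, ← add_smul, add_comm, hab, one_smul]
        rw [this]
        exact Submodule.add_mem _ (Submodule.smul_mem_smul hb hu)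
          (Submodule.smul_mem_smul hfm (N.smul_mem a hvN))
      obtain ⟨r, hr, hrN⟩ := Submodule.exists_sub_one_mem_and_smul_eq_zero_of_fg_of_le_smul m N
        (IsNoetherian.noetherian N) hNm
      have h1 : r ∈ m := hpm ((hw' r).2 (hrN w hwN))
      exact (Ideal.IsMaximal.ne_top ‹_› : m ≠ ⊤) ((Ideal.eq_top_iff_one m).2 (by
        simpa using m.sub_mem h1 hr))
    let φ : M →ₗ[R] M := LinearMap.lsmul R M f
    have hφ : Function.Injective φ := (injective_iff_map_eq_zero φ).2 fun x hx => hf x hx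
    have hMd : DepthGE m d (M ⧸ LinearMap.range φ) :=
      DepthGE.right (f := φ) (g := (LinearMap.range φ).mkQ) hφ (Submodule.mkQ_surjective _)
        (LinearMap.exact_map_mkQ_range φ) (hM.mono (Nat.le_succ d)) hM
    have hmk : ∀ r : R, r • (LinearMap.range φ).mkQ u = 0 ↔ ∃ v : M, r • u = f • v := fun r => by
      rw [← map_smul, Submodule.mkQ_apply, Submodule.Quotient.mk_eq_zero]
      exact ⟨fun ⟨v, hv⟩ => ⟨v, hv.symm⟩, fun ⟨v, hv⟩ => ⟨v, hv.symm⟩⟩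
    obtain ⟨q, hq, hqu, hqd⟩ := ih hMd ((LinearMap.range φ).mkQ u) fun r hr => hu r ((hmk r).1 hr)
    have hpq : p ≤ q := fun r hr => hqu r ((hmk r).2 ⟨0, by rw [(hN u).1 huN r hr, smul_zero]⟩)
    have hfq : f ∈ q := hqu f ((hmk f).2 ⟨u, rfl⟩)
    refine ⟨p, hpp, fun r hr => hp.1.2 (by simpa [Submodule.mem_colon_singleton] using hr), ?_⟩
    have hfp' : Ideal.Quotient.mk p f ∈ nonZeroDivisors (R ⧸ p) :=
      mem_nonZeroDivisors_of_ne_zero fun h => hfp (Ideal.Quotient.eq_zero_iff_mem.1 h)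
    have h := ringKrullDim_succ_le_of_surjective (Ideal.Quotient.factor hpq)
      (Ideal.Quotient.factor_surjective hpq) hfp'
      (by rw [Ideal.Quotient.factor_mk, Ideal.Quotient.eq_zero_iff_mem.2 hfq])
    refine le_trans ?_ h
    push_cast
    gcongr

end DepthPrime

section VarIdeal

variable (k : Type) [Field k] {σ : Type}

/-- The ideal generated by a set of variables. -/
def varIdeal (V : Set σ) : Ideal (MvPolynomial σ k) := Ideal.span (X '' V)

variable {k}

lemma mem_varIdeal {V : Set σ} {p : MvPolynomial σ k} :
    p ∈ varIdeal k V ↔ ∀ d ∈ p.support, ∃ i ∈ V, d i ≠ 0 :=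
  mem_ideal_span_X_image

lemma X_mem_varIdeal {V : Set σ} {i : σ} : (X i : MvPolynomial σ k) ∈ varIdeal k V ↔ i ∈ V := by
  classical
  simp [mem_varIdeal, support_X, Finsupp.single_apply]

lemma varIdeal_insert (v : σ) (V : Set σ) :
    varIdeal k (insert v V) = Ideal.span {X v} ⊔ varIdeal k V := by
  rw [varIdeal, Set.image_insert_eq, Ideal.span_insert, varIdeal]

lemma ker_killCompl (V : Set σ) :
    RingHom.ker (killCompl (R := k) (Subtype.val_injective (p := (· ∈ Vᶜ)))) = varIdeal k V := by
  refine le_antisymm (fun p hp => ?_) ?_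
  · have h : (Ideal.Quotient.mkₐ k (varIdeal k V)) =
        ((Ideal.Quotient.mkₐ k (varIdeal k V)).comp (rename Subtype.val)).comp
          (killCompl (R := k) (Subtype.val_injective (p := (· ∈ Vᶜ)))) := by
      refine algHom_ext fun i => ?_
      by_cases hi : i ∈ V
      · rw [Ideal.Quotient.mkₐ_eq_mk, Ideal.Quotient.eq_zero_iff_mem.2 (X_mem_varIdeal.2 hi)]
        simp [killCompl, hi]
      · have : (X i : MvPolynomial σ k) = rename Subtype.val (X (⟨i, hi⟩ : {i // i ∈ Vᶜ})) := by
          simp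
        rw [AlgHom.comp_apply, AlgHom.comp_apply, this, killCompl_rename_app]
    have h' := DFunLike.congr_fun h p
    rw [AlgHom.comp_apply, (RingHom.mem_ker).1 hp, map_zero] at h'
    exact Ideal.Quotient.eq_zero_iff_mem.1 h'
  · rw [varIdeal, Ideal.span_le]
    rintro _ ⟨i, hi, rfl⟩
    rw [SetLike.mem_coe, RingHom.mem_ker]
    simp [killCompl, hi]

/-- The quotient by a set of variables is a polynomial ring in the remaining ones. -/
def quotientVarIdealEquiv (V : Set σ) :
    (MvPolynomial σ k ⧸ varIdeal k V) ≃+* MvPolynomial {i // i ∈ Vᶜ} k :=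
  (Ideal.quotEquivOfEq (ker_killCompl V).symm).trans
    (RingHom.quotientKerEquivOfSurjective
      (f := (killCompl (R := k) (Subtype.val_injective (p := (· ∈ Vᶜ)))).toRingHom)
      fun p => ⟨_, killCompl_rename_app _ p⟩)

instance (V : Set σ) : (varIdeal k V).IsPrime := by
  rw [← ker_killCompl]
  exact RingHom.ker_isPrime _

lemma ringKrullDim_quotient_varIdeal [Finite σ] (V : Set σ) :
    ringKrullDim (MvPolynomial σ k ⧸ varIdeal k V) = Vᶜ.ncard := by
  rw [ringKrullDim_eq_of_ringEquiv (quotientVarIdealEquiv V),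
    MvPolynomial.ringKrullDim_of_isNoetherianRing, ringKrullDim_eq_zero_of_field, zero_add]
  rfl

lemma depthGE_quotient_varIdeal [Finite σ] (c : ℕ) :
    ∀ V : Set σ, Vᶜ.ncard = c →
      DepthGE (maxIdeal k σ) c (MvPolynomial σ k ⧸ varIdeal k V) := by
  induction c with
  | zero => exact fun V _ => depthGE_zero
  | succ c ih =>
    intro V hV
    obtain ⟨v, hv⟩ : Vᶜ.Nonempty := Set.nonempty_of_ncard_ne_zero (by lia)
    have hle : varIdeal k V ≤ varIdeal k (insert v V) := by
      rw [varIdeal_insert]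
      exact le_sup_right
    have hc : DepthGE (maxIdeal k σ) c (MvPolynomial σ k ⧸ varIdeal k (insert v V)) := by
      refine ih _ ?_
      have h : (insert v V)ᶜ = Vᶜ \ {v} := by
        ext
        simp [and_comm]
      rw [h, Set.ncard_sdiff_singleton_of_mem hv, hV, Nat.add_sub_cancel]
    have hXv : (X v : MvPolynomial σ k) ∈ maxIdeal k σ := Ideal.subset_span ⟨v, rfl⟩
    have hX : Ideal.Quotient.mk (varIdeal k V) (X v) ≠ 0 := fun h =>
      hv (X_mem_varIdeal.1 (Ideal.Quotient.eq_zero_iff_mem.1 h))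
    refine DepthGE.succ_of_regular hXv (g := Submodule.factor hle) ?_
      (Submodule.factor_surjective hle) ?_ hc
    · rw [← LinearMap.ker_eq_bot, LinearMap.ker_eq_bot']
      intro z hz
      obtain ⟨z, rfl⟩ := Ideal.Quotient.mk_surjective z
      exact (mul_eq_zero.1 (show Ideal.Quotient.mk _ (X v) * Ideal.Quotient.mk _ z = 0 from
        hz)).resolve_left hX
    · intro z
      obtain ⟨z, rfl⟩ := Submodule.mkQ_surjective _ z
      rw [Submodule.factor_mk, Submodule.mkQ_apply, Submodule.Quotient.mk_eq_zero, varIdeal_insert,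
        Ideal.mem_span_singleton_sup]
      constructor
      · rintro ⟨a, b, hb, rfl⟩
        refine ⟨Submodule.Quotient.mk a, ?_⟩
        rw [LinearMap.lsmul_apply, ← Submodule.Quotient.mk_smul, Submodule.mkQ_apply,
          Submodule.Quotient.eq]
        simpa [mul_comm] using hb
      · rintro ⟨a, ha⟩
        obtain ⟨a, rfl⟩ := Submodule.mkQ_surjective _ a
        rw [LinearMap.lsmul_apply, Submodule.mkQ_apply, ← Submodule.Quotient.mk_smul, eq_comm,
          Submodule.mkQ_apply, Submodule.Quotient.eq] at ha
        exact ⟨a, _, ha, by simp [mul_comm]⟩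

instance : (maxIdeal k σ).IsMaximal := by
  have h : maxIdeal k σ = RingHom.ker (constantCoeff (R := k) (σ := σ)) := by
    ext p
    rw [maxIdeal, ← Set.image_univ, mem_ideal_span_X_image, RingHom.mem_ker, constantCoeff_eq]
    constructor
    · intro h
      by_contra h0
      obtain ⟨i, -, hi⟩ := h 0 (mem_support_iff.2 h0)
      exact hi rfl
    · intro h d hd
      by_contra! H
      obtain rfl : d = 0 := Finsupp.ext fun i => H i trivial
      exact mem_support_iff.1 hd h
  rw [h]
  exact RingHom.ker_isMaximal_of_surjective _ fun a => ⟨C a, by simp⟩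

end VarIdeal

section PrimeDim

variable {R : Type} [CommRing R]

/-- If a product of ideals `Q i` of dimension at most `e` lies in `a`, then `dim R / a ≤ e`. -/
lemma ringKrullDim_quotient_le_of_prod_le {ι : Type} {s : Finset ι} {Q : ι → Ideal R}
    {a : Ideal R} {e : WithBot ℕ∞} (hs : ∏ i ∈ s, Q i ≤ a)
    (h : ∀ i ∈ s, ringKrullDim (R ⧸ Q i) ≤ e) : ringKrullDim (R ⧸ a) ≤ e := by
  rw [ringKrullDim_quotient]
  refine iSup_le fun l => ?_
  obtain ⟨i, hi, hip⟩ := (l.head.1.isPrime.prod_le).1 (hs.trans l.head.2)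
  refine le_trans ?_ (h i hi)
  rw [ringKrullDim_quotient]
  exact Order.LTSeries.length_le_krullDim (LTSeries.mk l.length
    (fun j => (⟨(l j).1, hip.trans (l.monotone (Fin.zero_le j))⟩ :
      PrimeSpectrum.zeroLocus (R := R) (Q i))) fun j j' hj => l.strictMono hj)

end PrimeDim

section IdealSequence

variable {R : Type} [CommRing R] (A B : Ideal R)

/-- The diagonal map `R / (A ∩ B) → R / A × R / B`. -/
def quotientInfToProd : (R ⧸ A ⊓ B) →ₗ[R] (R ⧸ A) × (R ⧸ B) :=
  (Submodule.factor inf_le_left).prod (Submodule.factor inf_le_right)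

/-- The difference map `R / A × R / B → R / (A + B)`. -/
def prodToQuotientSup : (R ⧸ A) × (R ⧸ B) →ₗ[R] (R ⧸ A ⊔ B) :=
  (Submodule.factor le_sup_left).coprod (-Submodule.factor le_sup_right)

lemma quotientInfToProd_injective : Function.Injective (quotientInfToProd A B) := by
  rw [injective_iff_map_eq_zero]
  intro z hz
  obtain ⟨z, rfl⟩ := Submodule.mkQ_surjective _ z
  have h1 : Submodule.mkQ A z = 0 := congr_arg Prod.fst hz
  have h2 : Submodule.mkQ B z = 0 := congr_arg Prod.snd hz
  rw [Submodule.mkQ_apply, Submodule.Quotient.mk_eq_zero] at h1 h2 ⊢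
  exact ⟨h1, h2⟩

lemma prodToQuotientSup_surjective : Function.Surjective (prodToQuotientSup A B) := by
  intro z
  obtain ⟨z, rfl⟩ := Submodule.mkQ_surjective _ z
  exact ⟨(Submodule.mkQ _ z, 0), by simp [prodToQuotientSup]⟩

lemma exact_quotientInfToProd :
    Function.Exact (quotientInfToProd A B) (prodToQuotientSup A B) := by
  rintro ⟨x, y⟩
  obtain ⟨x, rfl⟩ := Submodule.mkQ_surjective _ x
  obtain ⟨y, rfl⟩ := Submodule.mkQ_surjective _ y
  have h : prodToQuotientSup A B (A.mkQ x, B.mkQ y) = (A ⊔ B).mkQ (x - y) := by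
    rw [map_sub, sub_eq_add_neg]
    rfl
  rw [h, Submodule.mkQ_apply, Submodule.Quotient.mk_eq_zero, Submodule.mem_sup]
  constructor
  · rintro ⟨a, ha, b, hb, hab⟩
    refine ⟨(A ⊓ B).mkQ (y + b), Prod.ext ?_ ?_⟩
    · refine (Submodule.Quotient.eq A).2 ?_
      rw [LinearMap.id_apply, show y + b - x = -a by linear_combination hab]
      exact A.neg_mem ha
    · refine (Submodule.Quotient.eq B).2 ?_
      rwa [LinearMap.id_apply, add_sub_cancel_left]
  · rintro ⟨z, hz⟩
    obtain ⟨z, rfl⟩ := Submodule.mkQ_surjective _ z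
    have h1 := (Submodule.Quotient.eq A).1 (congr_arg Prod.fst hz)
    have h2 := (Submodule.Quotient.eq B).1 (congr_arg Prod.snd hz)
    exact ⟨-(z - x), A.neg_mem h1, z - y, h2, by ring⟩

variable {A B} {J : Ideal R} {d : ℕ}

lemma DepthGE.prod {M N : Type} [AddCommGroup M] [Module R M] [AddCommGroup N] [Module R N]
    (hM : DepthGE J d M) (hN : DepthGE J d N) : DepthGE J d (M × N) :=
  DepthGE.middle (f := LinearMap.inl R M N) (g := LinearMap.snd R M N) LinearMap.inl_injective
    LinearMap.snd_surjective Function.Exact.inl_snd hM hN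

lemma DepthGE.quotient_inf (hA : DepthGE J (d + 1) (R ⧸ A)) (hB : DepthGE J (d + 1) (R ⧸ B))
    (hAB : DepthGE J d (R ⧸ A ⊔ B)) : DepthGE J (d + 1) (R ⧸ A ⊓ B) :=
  DepthGE.left (quotientInfToProd_injective A B) (prodToQuotientSup_surjective A B)
    (exact_quotientInfToProd A B) (hA.prod hB) hAB

lemma DepthGE.quotient_sup (hA : DepthGE J d (R ⧸ A)) (hB : DepthGE J d (R ⧸ B))
    (hAB : DepthGE J (d + 1) (R ⧸ A ⊓ B)) : DepthGE J d (R ⧸ A ⊔ B) :=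
  DepthGE.right (quotientInfToProd_injective A B) (prodToQuotientSup_surjective A B)
    (exact_quotientInfToProd A B) (hA.prod hB) hAB

end IdealSequence

section Corner

/-- The first `a` row variables and the first `b` column variables. -/
def cornerVars (n m a b : ℕ) : Set (Fin n ⊕ Fin m) :=
  {v | Sum.elim (fun i : Fin n => (i : ℕ) < a) (fun j : Fin m => (j : ℕ) < b) v}

lemma ncard_compl_cornerVars {n m a b : ℕ} (ha : a ≤ n) (hb : b ≤ m) :
    (cornerVars n m a b)ᶜ.ncard + (a + b) = n + m := by
  have h : (cornerVars n m a b).ncard = a + b := by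
    have : cornerVars n m a b = (Sum.inl '' {i : Fin n | (i : ℕ) < a}) ∪
        (Sum.inr '' {j : Fin m | (j : ℕ) < b}) := by
      ext (i | j) <;> simp [cornerVars]
    rw [this, Set.ncard_union_eq, Set.ncard_image_of_injective _ Sum.inl_injective,
      Set.ncard_image_of_injective _ Sum.inr_injective]
    · congr 1
      · rw [Set.ncard_eq_toFinset_card']
        simp [Fin.card_filter_val_lt, ha]
      · rw [Set.ncard_eq_toFinset_card']
        simp [Fin.card_filter_val_lt, hb]
    · rw [Set.disjoint_left]
      rintro _ ⟨i, -, rfl⟩ ⟨j, -, h⟩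
      cases h
  rw [← h, add_comm, Set.ncard_add_ncard_compl]
  simp

variable (k : Type) [Field k] (n m : ℕ)

/-- The prime ideal generated by the first `a` row and the first `b` column variables. -/
def cornerIdeal (a b : ℕ) : Ideal (MvPolynomial (Fin n ⊕ Fin m) k) :=
  varIdeal k (cornerVars n m a b)

instance (a b : ℕ) : (cornerIdeal k n m a b).IsPrime :=
  inferInstanceAs (varIdeal k (cornerVars n m a b)).IsPrime

variable {k n m}

lemma X_inl_mem_cornerIdeal {a b : ℕ} {i : Fin n} :
    (X (Sum.inl i) : MvPolynomial (Fin n ⊕ Fin m) k) ∈ cornerIdeal k n m a b ↔ (i : ℕ) < a :=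
  X_mem_varIdeal

lemma X_inr_mem_cornerIdeal {a b : ℕ} {j : Fin m} :
    (X (Sum.inr j) : MvPolynomial (Fin n ⊕ Fin m) k) ∈ cornerIdeal k n m a b ↔ (j : ℕ) < b :=
  X_mem_varIdeal

lemma mem_cornerIdeal {a b : ℕ} {p : MvPolynomial (Fin n ⊕ Fin m) k} :
    p ∈ cornerIdeal k n m a b ↔ ∀ d ∈ p.support,
      (∃ i : Fin n, (i : ℕ) < a ∧ d (Sum.inl i) ≠ 0) ∨
        ∃ j : Fin m, (j : ℕ) < b ∧ d (Sum.inr j) ≠ 0 := by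
  rw [cornerIdeal, mem_varIdeal]
  simp [cornerVars]

lemma cornerIdeal_le {a b : ℕ} {I : Ideal (MvPolynomial (Fin n ⊕ Fin m) k)} :
    cornerIdeal k n m a b ≤ I ↔ (∀ i : Fin n, (i : ℕ) < a → X (Sum.inl i) ∈ I) ∧
      ∀ j : Fin m, (j : ℕ) < b → X (Sum.inr j) ∈ I := by
  rw [cornerIdeal, varIdeal, Ideal.span_le, Set.image_subset_iff]
  constructor
  · exact fun h => ⟨fun i hi => h (show Sum.inl i ∈ cornerVars n m a b from hi),
      fun j hj => h (show Sum.inr j ∈ cornerVars n m a b from hj)⟩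
  · rintro ⟨h1, h2⟩ (i | j) h
    · exact h1 i h
    · exact h2 j h

lemma cornerIdeal_mono {a b a' b' : ℕ} (ha : a ≤ a') (hb : b ≤ b') :
    cornerIdeal k n m a b ≤ cornerIdeal k n m a' b' :=
  cornerIdeal_le.2 ⟨fun _ hi => X_inl_mem_cornerIdeal.2 (hi.trans_le ha),
    fun _ hj => X_inr_mem_cornerIdeal.2 (hj.trans_le hb)⟩

lemma ringKrullDim_quotient_cornerIdeal {a b : ℕ} (ha : a ≤ n) (hb : b ≤ m) :
    ringKrullDim (MvPolynomial (Fin n ⊕ Fin m) k ⧸ cornerIdeal k n m a b) =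
      ((n + m - (a + b) : ℕ) : WithBot ℕ∞) := by
  rw [cornerIdeal, ringKrullDim_quotient_varIdeal,
    Nat.eq_sub_of_add_eq (ncard_compl_cornerVars ha hb)]

lemma depthGE_quotient_cornerIdeal {a b e : ℕ} (ha : a ≤ n) (hb : b ≤ m)
    (he : e + (a + b) ≤ n + m) :
    DepthGE (maxIdeal k (Fin n ⊕ Fin m)) e
      (MvPolynomial (Fin n ⊕ Fin m) k ⧸ cornerIdeal k n m a b) :=
  (depthGE_quotient_varIdeal _ _ rfl).mono (by have := ncard_compl_cornerVars ha hb; lia)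

variable (k n m)

/-- The intersection of the minimal-prime candidates of a Ferrers ideal indexed by `T`. -/
def cornerInf (lam : ℕ → ℕ) (T : Finset ℕ) : Ideal (MvPolynomial (Fin n ⊕ Fin m) k) :=
  ⨅ a ∈ T, cornerIdeal k n m a (lam a)

variable {k n m} {lam : ℕ → ℕ}

lemma mem_cornerInf {T : Finset ℕ} {p : MvPolynomial (Fin n ⊕ Fin m) k} :
    p ∈ cornerInf k n m lam T ↔ ∀ a ∈ T, p ∈ cornerIdeal k n m a (lam a) := by
  simp [cornerInf]

lemma cornerInf_le {T : Finset ℕ} {a : ℕ} (ha : a ∈ T) :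
    cornerInf k n m lam T ≤ cornerIdeal k n m a (lam a) :=
  fun _ hp => mem_cornerInf.1 hp a ha

lemma cornerInf_anti {T T' : Finset ℕ} (h : T ⊆ T') :
    cornerInf k n m lam T' ≤ cornerInf k n m lam T :=
  fun _ hp => mem_cornerInf.2 fun a ha => mem_cornerInf.1 hp a (h ha)

lemma cornerInf_union (T T' : Finset ℕ) :
    cornerInf k n m lam (T ∪ T') = cornerInf k n m lam T ⊓ cornerInf k n m lam T' := by
  ext p
  simp only [Submodule.mem_inf, mem_cornerInf, Finset.mem_union]
  grind

lemma prod_cornerIdeal_le (T : Finset ℕ) :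
    ∏ a ∈ T, cornerIdeal k n m a (lam a) ≤ cornerInf k n m lam T :=
  fun _ hp => mem_cornerInf.2 fun _ ha =>
    (Ideal.prod_le_inf.trans (Finset.inf_le ha)) hp

lemma cornerInf_sup (hlam : Antitone lam) {T T' : Finset ℕ} {s t : ℕ} (hs : s ∈ T) (ht : t ∈ T')
    (hT : ∀ a ∈ T, a ≤ s) (hT' : ∀ a ∈ T', t ≤ a) (hst : s ≤ t) :
    cornerInf k n m lam T ⊔ cornerInf k n m lam T' = cornerIdeal k n m t (lam s) := by
  refine le_antisymm (sup_le ((cornerInf_le hs).trans (cornerIdeal_mono hst le_rfl))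
    ((cornerInf_le ht).trans (cornerIdeal_mono le_rfl (hlam hst)))) (cornerIdeal_le.2 ⟨?_, ?_⟩)
  · exact fun i hi => Ideal.mem_sup_right (mem_cornerInf.2 fun a ha =>
      X_inl_mem_cornerIdeal.2 (hi.trans_le (hT' a ha)))
  · exact fun j hj => Ideal.mem_sup_left (mem_cornerInf.2 fun a ha =>
      X_inr_mem_cornerIdeal.2 (hj.trans_le (hlam (hT a ha))))

lemma skewIdeal_eq_cornerInf (hpart : IsPartitionFn n lam) :
    skewIdeal k n lam (fun _ => 0) = cornerInf k n (lam 0) lam (Finset.range (n + 1)) := by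
  obtain ⟨-, hlam, -, h0⟩ := hpart
  refine le_antisymm (Ideal.span_le.2 ?_) fun p hp => ?_
  · rintro _ ⟨i, j, -, hj, rfl⟩
    refine mem_cornerInf.2 fun a _ => ?_
    rcases lt_or_ge (i : ℕ) a with h | h
    · exact Ideal.mul_mem_right _ _ (X_inl_mem_cornerIdeal.2 h)
    · exact Ideal.mul_mem_left _ _ (X_inr_mem_cornerIdeal.2 (hj.trans_le (hlam h)))
  · have hspan : skewIdeal k n lam (fun _ => 0) = Ideal.span ((fun d => monomial d (1 : k)) ''
        {d | ∃ (i : Fin n) (j : Fin (lam 0)), (j : ℕ) < lam i ∧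
          d = Finsupp.single (Sum.inl i) 1 + Finsupp.single (Sum.inr j) 1}) := by
      rw [skewIdeal]
      congr 1
      ext q
      constructor
      · rintro ⟨i, j, -, hj, rfl⟩
        exact ⟨_, ⟨i, j, hj, rfl⟩, by simp [X, monomial_mul]⟩
      · rintro ⟨_, ⟨i, j, hj, rfl⟩, rfl⟩
        exact ⟨i, j, Nat.zero_le _, hj, by simp [X, monomial_mul]⟩
    rw [hspan, mem_ideal_span_monomial_image]
    intro d hd
    have key : ∀ a ≤ n, (∀ i : Fin n, (i : ℕ) < a → d (Sum.inl i) = 0) →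
        ∃ j : Fin (lam 0), (j : ℕ) < lam a ∧ d (Sum.inr j) ≠ 0 := fun a ha h =>
      (mem_cornerIdeal.1 (mem_cornerInf.1 hp a (Finset.mem_range.2 (by lia))) d hd).resolve_left
        fun ⟨i, hi, hi'⟩ => hi' (h i hi)
    have hex : ∃ i : ℕ, ∃ h : i < n, d (Sum.inl ⟨i, h⟩) ≠ 0 := by
      by_contra! H
      obtain ⟨j, hj, -⟩ := key n le_rfl fun i _ => H i i.2
      rw [h0 n le_rfl] at hj
      exact absurd hj (Nat.not_lt_zero _)
    classical
    obtain ⟨hi, hdi⟩ := Nat.find_spec hex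
    obtain ⟨j, hj, hdj⟩ := key (Nat.find hex) hi.le fun i hlt => by
      by_contra h
      exact Nat.find_min hex hlt ⟨i.2, h⟩
    refine ⟨_, ⟨⟨_, hi⟩, j, hj, rfl⟩, fun v => ?_⟩
    rcases v with i' | j'
    · rcases eq_or_ne ⟨Nat.find hex, hi⟩ i' with rfl | h
      · simpa [Nat.one_le_iff_ne_zero] using hdi
      · simp [h]
    · rcases eq_or_ne j j' with rfl | h
      · simpa [Nat.one_le_iff_ne_zero] using hdj
      · simp [h]

lemma depthGE_quotient_cornerInf (hlam : Antitone lam) (hm : lam 0 ≤ m) {e : ℕ} (T : Finset ℕ) :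
    (∀ a ∈ T, a ≤ n) → (∀ a ∈ T, e + (a + lam a) ≤ n + m) →
      (∀ s ∈ T, ∀ t ∈ T, s < t → (∀ u ∈ T, s < u → t ≤ u) → e + (t + lam s) ≤ n + m + 1) →
      DepthGE (maxIdeal k (Fin n ⊕ Fin m)) e
        (MvPolynomial (Fin n ⊕ Fin m) k ⧸ cornerInf k n m lam T) := by
  have hm' : ∀ a, lam a ≤ m := fun a => (hlam (Nat.zero_le a)).trans hm
  induction T using Finset.induction_on_max with
  | empty =>
    intro _ _ _
    have : Subsingleton (MvPolynomial (Fin n ⊕ Fin m) k ⧸ cornerInf k n m lam ∅) := by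
      rw [Ideal.Quotient.subsingleton_iff]
      simp [cornerInf]
    exact DepthGE.of_subsingleton _
  | insert t T hT ih =>
    intro h1 h2 h3
    have hQ : cornerInf k n m lam {t} = cornerIdeal k n m t (lam t) := by simp [cornerInf]
    have ht := h1 t (Finset.mem_insert_self _ _)
    have htd : DepthGE (maxIdeal k (Fin n ⊕ Fin m)) e
        (MvPolynomial (Fin n ⊕ Fin m) k ⧸ cornerInf k n m lam {t}) := by
      rw [hQ]
      exact depthGE_quotient_cornerIdeal ht (hm' t) (h2 t (Finset.mem_insert_self _ _))
    rcases T.eq_empty_or_nonempty with rfl | hne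
    · exact htd
    · rcases e with _ | e
      · exact depthGE_zero
      have hmem := T.max'_mem hne
      have hTd := ih (fun a ha => h1 a (Finset.mem_insert_of_mem ha))
        (fun a ha => h2 a (Finset.mem_insert_of_mem ha))
        (fun s hs u hu hsu h => h3 s (Finset.mem_insert_of_mem hs) u (Finset.mem_insert_of_mem hu)
          hsu fun v hv hsv => by
            rcases Finset.mem_insert.1 hv with rfl | hv
            · exact (hT u hu).le
            · exact h v hv hsv)
      rw [Finset.insert_eq, Finset.union_comm, cornerInf_union]
      refine DepthGE.quotient_inf hTd htd ?_
      rw [cornerInf_sup hlam hmem (Finset.mem_singleton_self t) (fun a ha => T.le_max' a ha)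
        (fun a ha => (Finset.mem_singleton.1 ha).ge) (hT _ hmem).le]
      refine depthGE_quotient_cornerIdeal ht (hm' _) ?_
      have := h3 _ (Finset.mem_insert_of_mem hmem) t (Finset.mem_insert_self _ _) (hT _ hmem)
        fun u hu hsu => by
          rcases Finset.mem_insert.1 hu with rfl | hu
          · exact le_rfl
          · exact absurd (T.le_max' u hu) (not_le.2 hsu)
      lia

end Corner

lemma smul_quotientMk_eq_zero_iff {R : Type} [CommRing R] {A : Ideal R} {r z : R} :
    r • Ideal.Quotient.mk A z = 0 ↔ r * z ∈ A :=
  Ideal.Quotient.eq_zero_iff_mem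

section Gaps

/-- The indices `a ≤ n` whose prime `(x_i, y_j : i < a, j < λ_a)` has dimension at least `L`. -/
def dimIndices (n : ℕ) (lam : ℕ → ℕ) (L : ℕ) : Finset ℕ :=
  (Finset.range (n + 1)).filter fun a => L + (a + lam a) ≤ n + lam 0

lemma mem_dimIndices {n : ℕ} {lam : ℕ → ℕ} {L a : ℕ} :
    a ∈ dimIndices n lam L ↔ a ≤ n ∧ L + (a + lam a) ≤ n + lam 0 := by
  simp [dimIndices]

/-- `s < t` are consecutive elements of `T`. -/
def IsConsecutive (T : Finset ℕ) (s t : ℕ) : Prop :=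
  s ∈ T ∧ t ∈ T ∧ s < t ∧ ∀ u ∈ T, s < u → t ≤ u

/-- Consecutive elements of `dimIndices n lam L` have primes meeting in codimension one. -/
def SmallGaps (n : ℕ) (lam : ℕ → ℕ) : Prop :=
  ∀ L s t, IsConsecutive (dimIndices n lam L) s t → L + (t + lam s) ≤ n + lam 0 + 1

variable {n : ℕ} {lam : ℕ → ℕ}

lemma IsSaturated.smallGaps (hlam : Antitone lam) (hsat : IsSaturated n lam) :
    SmallGaps n lam := by
  rintro L s t ⟨hs, ht, hst, hcons⟩
  rw [mem_dimIndices] at hs ht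
  rcases eq_or_ne t (s + 1) with rfl | hne
  · lia
  have h1 : lam s = lam (s + 1) := by
    have h := hlam (Nat.le_succ s)
    by_contra hlt
    have := hcons (s + 1) (mem_dimIndices.2 ⟨by lia, by lia⟩) (by lia)
    lia
  rcases hsat with hsat | ⟨i, hi, hii, hmin, hv⟩
  · have := hsat (show s < n by lia) (show s + 1 < n by lia) (Nat.lt_succ_self s)
    lia
  have his : i ≤ s := not_lt.1 fun h => hmin s h h1
  have h2 : lam (t - 1) ≤ lam t + 1 := by
    by_contra! h
    obtain ⟨a, -, ha⟩ := hv (lam t + 1) (Nat.succ_pos _)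
      (h.le.trans (hlam (show i ≤ t - 1 by lia)))
    rcases lt_or_ge a t with hat | hat
    · have := hlam (show a ≤ t - 1 by lia)
      lia
    · have := hlam hat
      lia
  have := hcons (t - 1) (mem_dimIndices.2 ⟨by lia, by lia⟩) (by lia)
  lia

lemma SmallGaps.isSaturated (hpart : IsPartitionFn n lam) (hgap : SmallGaps n lam) :
    IsSaturated n lam := by
  classical
  obtain ⟨hn, hlam, -, h0⟩ := hpart
  by_cases hex : ∃ i, i + 1 < n ∧ lam i = lam (i + 1)
  swap
  · refine Or.inl fun a ha b hb hab => ?_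
    push Not at hex
    rw [Set.mem_Iio] at ha hb
    have h1 := hex a (by lia)
    have h2 := hlam (Nat.le_succ a)
    have h3 := hlam (Nat.succ_le_of_lt hab)
    simp only [Nat.succ_eq_add_one] at h2 h3
    lia
  refine Or.inr ⟨Nat.find hex, (Nat.find_spec hex).1, (Nat.find_spec hex).2, fun j hj hjj =>
    Nat.find_min hex hj ⟨by have := (Nat.find_spec hex).1; lia, hjj⟩, ?_⟩
  obtain ⟨hi, hii⟩ := Nat.find_spec hex
  generalize Nat.find hex = i at hi hii
  intro v hv0 hvi
  by_contra! hv
  have hjump : ∃ t, t ≤ n ∧ i < t ∧ lam t + 2 ≤ lam (t - 1) := by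
    have hlt : ∃ t, lam t < v := ⟨n, by rw [h0 n le_rfl]; exact hv0⟩
    have ht := Nat.find_spec hlt
    have htn : Nat.find hlt ≤ n := Nat.find_min' hlt (by rw [h0 n le_rfl]; exact hv0)
    have hit : i < Nat.find hlt := by
      by_contra! h
      have := hlam h
      lia
    have h1 : v ≤ lam (Nat.find hlt - 1) := not_lt.1 (Nat.find_min hlt (by lia))
    have h2 := hv (Nat.find hlt - 1) (by lia)
    exact ⟨_, htn, hit, by lia⟩
  obtain ⟨htn, hit, htj⟩ := Nat.find_spec hjump
  have hmin : ∀ u, i < u → u < Nat.find hjump → lam (u - 1) < lam u + 2 := fun u hu hut => by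
    have := Nat.find_min hjump hut
    by_contra! h
    exact this ⟨by lia, hu, h⟩
  generalize Nat.find hjump = t at htn hit htj hmin
  have hmono : ∀ a, i + 1 ≤ a → a < t → i + lam i + 1 ≤ a + lam a := by
    intro a ha
    induction a, ha using Nat.le_induction with
    | base => lia
    | succ a ha ih =>
      intro hat
      have := ih (by lia)
      have := hmin (a + 1) (by lia) hat
      rw [Nat.add_sub_cancel] at this
      lia
  have hit2 : i + 1 < t := by
    rcases Nat.lt_or_eq_of_le (Nat.succ_le_of_lt hit) with h | h
    · exact h
    · subst h
      simp only [Nat.succ_eq_add_one, Nat.add_sub_cancel] at htj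
      lia
  have hD := hmono (t - 1) (by lia) (by lia)
  set D := t - 1 + lam (t - 1) - 1 with hDdef
  have hDN : D ≤ n + lam 0 := by
    have := hlam (Nat.zero_le (t - 1))
    lia
  set s := Nat.findGreatest (fun a => a + lam a ≤ D) (t - 1) with hs
  have his : i + lam i ≤ D := by lia
  have hsD : s + lam s ≤ D :=
    Nat.findGreatest_spec (P := fun a => a + lam a ≤ D) (show i ≤ t - 1 by lia) his
  have hst : s ≤ t - 1 := Nat.findGreatest_le _
  have hlamst := hlam hst
  have := hgap (n + lam 0 - D) s t ⟨mem_dimIndices.2 ⟨by lia, by lia⟩,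
    mem_dimIndices.2 ⟨by lia, by lia⟩, by lia, fun u hu hsu => by
      by_contra! hut
      exact Nat.findGreatest_is_greatest hsu (show u ≤ t - 1 by lia)
        (by have := (mem_dimIndices.1 hu).2; lia)⟩
  lia

variable {k : Type} [Field k]

lemma SmallGaps.depthGE (hlam : Antitone lam) (hgap : SmallGaps n lam) (L : ℕ) :
    DepthGE (maxIdeal k (Fin n ⊕ Fin (lam 0))) L
      (MvPolynomial (Fin n ⊕ Fin (lam 0)) k ⧸ cornerInf k n (lam 0) lam (dimIndices n lam L)) :=
  depthGE_quotient_cornerInf hlam le_rfl _ (fun _ ha => (mem_dimIndices.1 ha).1)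
    (fun _ ha => (mem_dimIndices.1 ha).2) fun s hs t ht hst h => hgap L s t ⟨hs, ht, hst, h⟩

lemma smallGaps_of_depthGE (hlam : Antitone lam)
    (hdepth : ∀ L, DepthGE (maxIdeal k (Fin n ⊕ Fin (lam 0))) L
      (MvPolynomial (Fin n ⊕ Fin (lam 0)) k ⧸ cornerInf k n (lam 0) lam (dimIndices n lam L))) :
    SmallGaps n lam := by
  classical
  intro L s₀ t₀ h₀
  by_contra! hlt₀
  set H := dimIndices n lam L with hH
  obtain ⟨⟨s, t⟩, hmem, hmax⟩ := Finset.exists_max_image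
    ((H ×ˢ H).filter fun p => IsConsecutive H p.1 p.2) (fun p => p.2 + lam p.1)
    ⟨(s₀, t₀), by simp [h₀, h₀.1, h₀.2.1]⟩
  have hmax' : ∀ s' t', IsConsecutive H s' t' → t' + lam s' ≤ t + lam s := fun s' t' h =>
    hmax (s', t') (by simp [h, h.1, h.2.1])
  obtain ⟨hs, ht, hst, hcons⟩ := (Finset.mem_filter.1 hmem).2
  simp only at hs ht hst hcons
  have hlt : t₀ + lam s₀ ≤ t + lam s := hmax' _ _ h₀
  have htn := (mem_dimIndices.1 ht).1
  have hs0 := hlam (Nat.zero_le s)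
  obtain ⟨j, hj⟩ : ∃ j, j + (t + lam s) = n + lam 0 := ⟨n + lam 0 - (t + lam s), by lia⟩
  have hjL : j + 2 ≤ L := by lia
  have hHn : ∀ a ∈ H, a ≤ n := fun a ha => (mem_dimIndices.1 ha).1
  have hHL : ∀ a ∈ H, j + 1 + (a + lam a) ≤ n + lam 0 := fun a ha => by
    have := (mem_dimIndices.1 ha).2
    lia
  have h1 : DepthGE (maxIdeal k (Fin n ⊕ Fin (lam 0))) (j + 1) (MvPolynomial _ k ⧸
      cornerInf k n (lam 0) lam (H.filter (· ≤ s))) := by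
    refine depthGE_quotient_cornerInf hlam le_rfl _ (fun a ha => hHn a (Finset.mem_filter.1 ha).1)
      (fun a ha => hHL a (Finset.mem_filter.1 ha).1) fun a ha b hb hab hc => ?_
    rw [Finset.mem_filter] at ha hb
    have := hmax' a b ⟨ha.1, hb.1, hab, fun u hu hau => by
      rcases le_or_gt u s with h | h
      · exact hc u (Finset.mem_filter.2 ⟨hu, h⟩) hau
      · exact hb.2.trans h.le⟩
    lia
  have h2 : DepthGE (maxIdeal k (Fin n ⊕ Fin (lam 0))) (j + 1) (MvPolynomial _ k ⧸
      cornerInf k n (lam 0) lam (H.filter (t ≤ ·))) := by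
    refine depthGE_quotient_cornerInf hlam le_rfl _ (fun a ha => hHn a (Finset.mem_filter.1 ha).1)
      (fun a ha => hHL a (Finset.mem_filter.1 ha).1) fun a ha b hb hab hc => ?_
    rw [Finset.mem_filter] at ha hb
    have := hmax' a b ⟨ha.1, hb.1, hab, fun u hu hau =>
      hc u (Finset.mem_filter.2 ⟨hu, ha.2.trans hau.le⟩) hau⟩
    lia
  have hunion : H = H.filter (· ≤ s) ∪ H.filter (t ≤ ·) := by
    ext u
    simp only [Finset.mem_union, Finset.mem_filter]
    constructor
    · intro hu
      rcases le_or_gt u s with h | h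
      · exact Or.inl ⟨hu, h⟩
      · exact Or.inr ⟨hu, hcons u hu h⟩
    · rintro (h | h) <;> exact h.1
  have h3 := (hdepth L).mono hjL
  rw [← hH, hunion, cornerInf_union] at h3
  have h4 := DepthGE.quotient_sup h1 h2 h3
  rw [cornerInf_sup (T := H.filter (· ≤ s)) (T' := H.filter (t ≤ ·)) hlam
    (Finset.mem_filter.2 ⟨hs, le_rfl⟩) (Finset.mem_filter.2 ⟨ht, le_rfl⟩)
    (fun a ha => (Finset.mem_filter.1 ha).2) (fun a ha => (Finset.mem_filter.1 ha).2) hst.le] at h4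
  have hmk : ∀ r : MvPolynomial (Fin n ⊕ Fin (lam 0)) k,
      r • Ideal.Quotient.mk (cornerIdeal k n (lam 0) t (lam s)) 1 = 0 ↔
        r ∈ cornerIdeal k n (lam 0) t (lam s) := fun r => by
    rw [smul_quotientMk_eq_zero_iff, mul_one]
  have hle : cornerIdeal k n (lam 0) t (lam s) ≤ maxIdeal k _ :=
    Ideal.span_mono (Set.image_subset_range _ _)
  obtain ⟨p, -, hp, hd⟩ := h4.exists_prime _ fun r hr => hle ((hmk r).1 hr)
  have hd' := hd.trans (ringKrullDim_le_of_surjective (Ideal.Quotient.factor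
    (show cornerIdeal k n (lam 0) t (lam s) ≤ p from fun r hr => hp r ((hmk r).2 hr)))
    (Ideal.Quotient.factor_surjective _))
  rw [ringKrullDim_quotient_cornerIdeal htn hs0] at hd'
  have : j + 1 ≤ n + lam 0 - (t + lam s) := by exact_mod_cast hd'
  lia

end Gaps

section Step

variable {R : Type} [CommRing R] {M : Type} [AddCommGroup M] [Module R M]

/-- The subquotient `Q / (P ∩ Q)` attached to two submodules. -/
abbrev StepQuot (P Q : Submodule R M) : Type :=
  ↥Q ⧸ Submodule.comap Q.subtype P

lemma mem_annihilator_stepQuot {P Q : Submodule R M} {r : R} :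
    r ∈ Module.annihilator R (StepQuot P Q) ↔ ∀ y ∈ Q, r • y ∈ P := by
  rw [Module.mem_annihilator]
  constructor
  · intro h y hy
    have := h (Submodule.Quotient.mk ⟨y, hy⟩)
    rw [← Submodule.Quotient.mk_smul, Submodule.Quotient.mk_eq_zero] at this
    exact this
  · intro h q
    obtain ⟨y, rfl⟩ := Submodule.Quotient.mk_surjective _ q
    rw [← Submodule.Quotient.mk_smul, Submodule.Quotient.mk_eq_zero]
    exact h y y.2

/-- The inclusion of `Q / P` into `M / P`. -/
def stepQuotToQuot (P Q : Submodule R M) : StepQuot P Q →ₗ[R] M ⧸ P :=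
  Submodule.mapQ _ _ Q.subtype le_rfl

lemma stepQuotToQuot_injective (P Q : Submodule R M) :
    Function.Injective (stepQuotToQuot P Q) := by
  rw [← LinearMap.ker_eq_bot, stepQuotToQuot, Submodule.ker_mapQ, Submodule.mkQ_map_self]

lemma exact_stepQuotToQuot {P Q : Submodule R M} (h : P ≤ Q) :
    Function.Exact (stepQuotToQuot P Q) (Submodule.factor h) := by
  intro y
  obtain ⟨y, rfl⟩ := Submodule.Quotient.mk_surjective _ y
  have h1 : Submodule.factor h (Submodule.Quotient.mk y) = Submodule.Quotient.mk y := rfl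
  rw [h1, Submodule.Quotient.mk_eq_zero]
  constructor
  · intro hy
    exact ⟨Submodule.Quotient.mk ⟨y, hy⟩, rfl⟩
  · rintro ⟨z, hz⟩
    obtain ⟨z, rfl⟩ := Submodule.Quotient.mk_surjective _ z
    have h2 : stepQuotToQuot P Q (Submodule.Quotient.mk z) = Submodule.Quotient.mk (z : M) := rfl
    rw [h2, Submodule.Quotient.eq] at hz
    simpa using Q.sub_mem z.2 (h hz)

lemma submoduleFactor_surjective {P Q : Submodule R M} (h : P ≤ Q) :
    Function.Surjective (Submodule.factor h) := fun y => by
  obtain ⟨y, rfl⟩ := Submodule.Quotient.mk_surjective _ y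
  exact ⟨Submodule.Quotient.mk y, rfl⟩

variable {J : Ideal R} {d : ℕ} {P Q : Submodule R M}

lemma DepthGE.stepQuot (h : P ≤ Q) (hP : DepthGE J (d + 1) (M ⧸ P)) (hQ : DepthGE J d (M ⧸ Q)) :
    DepthGE J (d + 1) (StepQuot P Q) :=
  DepthGE.left (stepQuotToQuot_injective P Q) (submoduleFactor_surjective h)
    (exact_stepQuotToQuot h) hP hQ

lemma DepthGE.quotient_of_stepQuot (h : P ≤ Q) (hPQ : DepthGE J d (StepQuot P Q))
    (hQ : DepthGE J d (M ⧸ Q)) : DepthGE J d (M ⧸ P) :=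
  DepthGE.middle (stepQuotToQuot_injective P Q) (submoduleFactor_surjective h)
    (exact_stepQuotToQuot h) hPQ hQ

/-- A chain of submodules whose `L`-th proper step is Cohen-Macaulay of dimension `L` can be
thinned out to a strict chain with strictly increasing dimensions. -/
lemma exists_strict_chain (J : Ideal R) (K : ℕ → Submodule R M) (G : Submodule R M → Prop)
    (hG : ∀ L, G (K L)) (hmono : ∀ L, K L ≤ K (L + 1))
    (hdim : ∀ L, K L ≠ K (L + 1) → moduleDim R (StepQuot (K L) (K (L + 1))) = L)
    (hdepth : ∀ L, DepthGE J L (StepQuot (K L) (K (L + 1)))) (L : ℕ) :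
    ∃ (r : ℕ) (N : ℕ → Submodule R M), N 0 = K 0 ∧ N r = K L ∧ (∀ i < r, N i < N (i + 1)) ∧
      (∀ i ≤ r, G (N i)) ∧ (∀ i < r, IsCMModule J (StepQuot (N i) (N (i + 1)))) ∧
      (∀ i, i + 2 ≤ r → moduleDim R (StepQuot (N i) (N (i + 1))) <
        moduleDim R (StepQuot (N (i + 1)) (N (i + 2)))) ∧
      ∀ i < r, moduleDim R (StepQuot (N i) (N (i + 1))) < L := by
  induction L with
  | zero => exact ⟨0, fun _ => K 0, rfl, rfl, by simp, fun _ _ => hG 0, by simp, by simp, by simp⟩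
  | succ L ih =>
    obtain ⟨r, N, h0, hr, hlt, hgr, hcm, hinc, hd⟩ := ih
    have hLL : (L : WithBot ℕ∞) < ((L + 1 : ℕ) : WithBot ℕ∞) := by exact_mod_cast L.lt_succ_self
    by_cases hK : K L = K (L + 1)
    · exact ⟨r, N, h0, hr.trans hK, hlt, hgr, hcm, hinc, fun i hi => (hd i hi).trans hLL⟩
    obtain ⟨N', hN⟩ : ∃ N' : ℕ → Submodule R M, N' = fun i => if i ≤ r then N i else K (L + 1) :=
      ⟨_, rfl⟩
    have hold : ∀ i ≤ r, N' i = N i := fun i hi => by simp [hN, hi]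
    have hnew : N' (r + 1) = K (L + 1) := by simp [hN]
    have hr' : N' r = K L := (hold r le_rfl).trans hr
    have hdr : moduleDim R (StepQuot (N' r) (N' (r + 1))) = L := by
      rw [hr', hnew]
      exact hdim L hK
    have hdo : ∀ i < r, moduleDim R (StepQuot (N' i) (N' (i + 1))) < L := fun i hi => by
      rw [hold i hi.le, hold (i + 1) hi]
      exact hd i hi
    refine ⟨r + 1, N', (hold 0 (zero_le)).trans h0, hnew, fun i hi => ?_, fun i hi => ?_,
      fun i hi => ?_, fun i hi => ?_, fun i hi => ?_⟩
    · rcases (Nat.lt_succ_iff_lt_or_eq.1 hi) with hi | rfl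
      · rw [hold i hi.le, hold (i + 1) hi]
        exact hlt i hi
      · rw [hr', hnew]
        exact lt_of_le_of_ne (hmono L) hK
    · rcases Nat.le_succ_iff.1 hi with hi | rfl
      · rw [hold i hi]
        exact hgr i hi
      · rw [Nat.succ_eq_add_one, hnew]
        exact hG _
    · rcases (Nat.lt_succ_iff_lt_or_eq.1 hi) with hi | rfl
      · rw [hold i hi.le, hold (i + 1) hi]
        exact hcm i hi
      · intro j hj
        rw [hdr] at hj
        rw [hr', hnew]
        exact hdepth L j (by exact_mod_cast hj)
    · rcases Nat.lt_or_ge (i + 1) r with h | h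
      · rw [hold i (by lia), hold (i + 1) h.le, hold (i + 2) h]
        exact hinc i h
      · obtain rfl : r = i + 1 := by lia
        rw [hdr]
        exact hdo i (by lia)
    · rcases (Nat.lt_succ_iff_lt_or_eq.1 hi) with hi | rfl
      · exact (hdo i hi).trans hLL
      · rw [hdr]
        exact hLL

end Step

section Quotient

variable {R : Type} [CommRing R] (I : Ideal R)

/-- Quotients of `R / I` are quotients of `R`. -/
def quotientComapEquiv (N : Submodule R (R ⧸ I)) :
    (R ⧸ N.comap I.mkQ) ≃ₗ[R] (R ⧸ I) ⧸ N :=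
  (Submodule.quotEquivOfEq _ _ (by rw [LinearMap.ker_comp, Submodule.ker_mkQ])).trans
    (LinearMap.quotKerEquivOfSurjective (N.mkQ ∘ₗ I.mkQ)
      ((Submodule.mkQ_surjective N).comp (Submodule.mkQ_surjective I)))

variable {I}

lemma DepthGE.quotient_map {J : Ideal R} {d : ℕ} {A : Ideal R} (hA : I ≤ A)
    (h : DepthGE J d (R ⧸ A)) : DepthGE J d ((R ⧸ I) ⧸ Submodule.map I.mkQ A) := by
  refine DepthGE.of_equiv h ((Submodule.quotEquivOfEq _ _ ?_).trans
    (quotientComapEquiv I (Submodule.map I.mkQ A)))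
  rw [Submodule.comap_map_mkQ, sup_eq_right.2 hA]

lemma DepthGE.quotient_comap {J : Ideal R} {d : ℕ} {N : Submodule R (R ⧸ I)}
    (h : DepthGE J d ((R ⧸ I) ⧸ N)) : DepthGE J d (R ⧸ N.comap I.mkQ) :=
  DepthGE.of_equiv h (quotientComapEquiv I N).symm

lemma mkQ_mem_map_iff {A : Ideal R} (hA : I ≤ A) {f : R} :
    I.mkQ f ∈ Submodule.map I.mkQ A ↔ f ∈ A := by
  rw [← Submodule.mem_comap, Submodule.comap_map_mkQ, sup_eq_right.2 hA]

end Quotient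

section Homogeneous

variable {k : Type} [Field k] {n m : ℕ}

attribute [local instance] MvPolynomial.gradedAlgebra

lemma isHomogeneous_cornerInf (lam : ℕ → ℕ) (T : Finset ℕ) :
    (cornerInf k n m lam T).IsHomogeneous (homogeneousSubmodule (Fin n ⊕ Fin m) k) := by
  refine Ideal.IsHomogeneous.iInf₂ fun a _ => Ideal.homogeneous_span _ _ ?_
  rintro _ ⟨v, -, rfl⟩
  exact ⟨1, isHomogeneous_X k v⟩

lemma isGradedSubmodule_map {σ : Type} {I A : Ideal (MvPolynomial σ k)}
    (hA : A.IsHomogeneous (homogeneousSubmodule σ k)) :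
    IsGradedSubmodule k σ I (Submodule.map I.mkQ A) := by
  refine ⟨A, hA, fun x => ?_⟩
  rw [Ideal.mem_map_iff_of_surjective _ Ideal.Quotient.mk_surjective]
  rfl

end Homogeneous

section Sufficiency

variable {k : Type} [Field k] {n : ℕ} {lam : ℕ → ℕ}

lemma dimIndices_anti {L L' : ℕ} (h : L ≤ L') : dimIndices n lam L' ⊆ dimIndices n lam L := by
  intro a ha
  rw [mem_dimIndices] at ha ⊢
  exact ⟨ha.1, by lia⟩

lemma dimIndices_zero (hlam : Antitone lam) : dimIndices n lam 0 = Finset.range (n + 1) := by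
  ext a
  rw [mem_dimIndices, Finset.mem_range]
  have := hlam (Nat.zero_le a)
  lia

lemma dimIndices_eq_empty : dimIndices n lam (n + lam 0 + 1) = ∅ := by
  ext a
  simp only [mem_dimIndices, Finset.notMem_empty, iff_false]
  lia

lemma ringKrullDim_quotient_cornerIdeal_le {L a : ℕ} (ha : a ≤ n) (h : lam a ≤ lam 0)
    (hL : n + lam 0 ≤ L + (a + lam a)) :
    ringKrullDim
      (MvPolynomial (Fin n ⊕ Fin (lam 0)) k ⧸ cornerIdeal k n (lam 0) a (lam a)) ≤ L := by
  rw [ringKrullDim_quotient_cornerIdeal ha h]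
  exact_mod_cast (by lia : n + lam 0 - (a + lam a) ≤ L)

lemma le_ringKrullDim_quotient_cornerIdeal {L a : ℕ} (ha : a ≤ n) (h : lam a ≤ lam 0)
    (hL : L + (a + lam a) ≤ n + lam 0) :
    L ≤ ringKrullDim
      (MvPolynomial (Fin n ⊕ Fin (lam 0)) k ⧸ cornerIdeal k n (lam 0) a (lam a)) := by
  rw [ringKrullDim_quotient_cornerIdeal ha h]
  exact_mod_cast (by lia : L ≤ n + lam 0 - (a + lam a))

lemma isSCMIdeal_cornerInf (hlam : Antitone lam) (hgap : SmallGaps n lam) :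
    IsSCMIdeal k (Fin n ⊕ Fin (lam 0)) (cornerInf k n (lam 0) lam (Finset.range (n + 1))) := by
  obtain ⟨I, hI⟩ : ∃ I, I = cornerInf k n (lam 0) lam (Finset.range (n + 1)) := ⟨_, rfl⟩
  obtain ⟨A, hA⟩ : ∃ A : ℕ → Ideal (MvPolynomial (Fin n ⊕ Fin (lam 0)) k),
    ∀ L, A L = cornerInf k n (lam 0) lam (dimIndices n lam L) := ⟨_, fun _ => rfl⟩
  rw [← hI]
  have hA0 : A 0 = I := by rw [hA, hI, dimIndices_zero hlam]
  have hmono : ∀ L L', L ≤ L' → A L ≤ A L' := fun L L' h => by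
    rw [hA, hA]
    exact cornerInf_anti (dimIndices_anti h)
  have hIA : ∀ L, I ≤ A L := fun L => hA0 ▸ hmono 0 L L.zero_le
  have hAtop : A (n + lam 0 + 1) = ⊤ := by
    rw [hA]
    simp [dimIndices_eq_empty, cornerInf]
  have hdepthA : ∀ L, DepthGE (maxIdeal k (Fin n ⊕ Fin (lam 0))) L
      (MvPolynomial (Fin n ⊕ Fin (lam 0)) k ⧸ A L) := fun L => by
    rw [hA]
    exact hgap.depthGE hlam L
  have hKmono : ∀ L, Submodule.map I.mkQ (A L) ≤ Submodule.map I.mkQ (A (L + 1)) := fun L =>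
    Submodule.map_mono (hmono _ _ L.le_succ)
  have hdim : ∀ L, Submodule.map I.mkQ (A L) ≠ Submodule.map I.mkQ (A (L + 1)) →
      moduleDim (MvPolynomial (Fin n ⊕ Fin (lam 0)) k)
        (StepQuot (Submodule.map I.mkQ (A L)) (Submodule.map I.mkQ (A (L + 1)))) = L := by
    intro L hL
    refine le_antisymm (ringKrullDim_quotient_le_of_prod_le
      (s := dimIndices n lam L \ dimIndices n lam (L + 1))
      (Q := fun a => cornerIdeal k n (lam 0) a (lam a)) (fun r hr => ?_) fun a ha => ?_) ?_
    · rw [mem_annihilator_stepQuot]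
      rintro _ ⟨f, hf, rfl⟩
      have hr' := mem_cornerInf.1 (prod_cornerIdeal_le _ hr)
      rw [← map_smul, mkQ_mem_map_iff (hIA L), hA, smul_eq_mul]
      rw [hA] at hf
      refine mem_cornerInf.2 fun a ha => ?_
      by_cases ha' : a ∈ dimIndices n lam (L + 1)
      · exact Ideal.mul_mem_left _ _ (mem_cornerInf.1 hf a ha')
      · exact Ideal.mul_mem_right _ _ (hr' a (Finset.mem_sdiff.2 ⟨ha, ha'⟩))
    · rw [Finset.mem_sdiff, mem_dimIndices, mem_dimIndices] at ha
      exact ringKrullDim_quotient_cornerIdeal_le ha.1.1 (hlam a.zero_le) (by lia)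
    · obtain ⟨_, ⟨f, hf, rfl⟩, hfL⟩ := SetLike.exists_of_lt (lt_of_le_of_ne (hKmono L) hL)
      rw [mkQ_mem_map_iff (hIA L), hA, mem_cornerInf] at hfL
      push Not at hfL
      obtain ⟨a, ha, hfa⟩ := hfL
      have ha' := mem_dimIndices.1 ha
      have hle : Module.annihilator _ (StepQuot (Submodule.map I.mkQ (A L))
          (Submodule.map I.mkQ (A (L + 1)))) ≤ cornerIdeal k n (lam 0) a (lam a) := fun r hr => by
        have h := mem_annihilator_stepQuot.1 hr _ ⟨f, hf, rfl⟩
        rw [← map_smul, mkQ_mem_map_iff (hIA L), hA, smul_eq_mul] at h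
        exact (Ideal.IsPrime.mem_or_mem inferInstance (mem_cornerInf.1 h a ha)).resolve_right hfa
      exact (le_ringKrullDim_quotient_cornerIdeal ha'.1 (hlam a.zero_le) ha'.2).trans
        (ringKrullDim_le_of_surjective (Ideal.Quotient.factor hle)
          (Ideal.Quotient.factor_surjective _))
  have hdepth : ∀ L, DepthGE (maxIdeal k (Fin n ⊕ Fin (lam 0))) L
      (StepQuot (Submodule.map I.mkQ (A L)) (Submodule.map I.mkQ (A (L + 1)))) := by
    intro L
    cases L with
    | zero => exact depthGE_zero
    | succ L =>
      exact DepthGE.stepQuot (hKmono _) ((hdepthA _).quotient_map (hIA _))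
        (((hdepthA (L + 2)).mono (by lia)).quotient_map (hIA _))
  obtain ⟨r, N, h0, hr, hlt, hgr, hcm, hinc, -⟩ := exists_strict_chain (maxIdeal k _)
    (fun L => Submodule.map I.mkQ (A L)) (IsGradedSubmodule k _ I)
    (fun L => isGradedSubmodule_map (by
      rw [hA]
      exact isHomogeneous_cornerInf _ _))
    hKmono hdim hdepth (n + lam 0 + 1)
  refine ⟨r, N, ?_, ?_, hlt, hgr, hcm, hinc⟩
  · rw [h0, hA0, Submodule.mkQ_map_self]
  · rw [hr, hAtop, Submodule.map_top, Submodule.range_mkQ]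

end Sufficiency

section HomogeneousColon

attribute [local instance] MvPolynomial.gradedAlgebra

variable {k σ : Type} [Field k]

lemma coeff_zero_ne_zero_of_notMem_maxIdeal {r : MvPolynomial σ k} (hr : r ∉ maxIdeal k σ) :
    coeff 0 r ≠ 0 := by
  rw [maxIdeal, ← Set.image_univ, mem_ideal_span_X_image] at hr
  push Not at hr
  obtain ⟨d, hd, hd0⟩ := hr
  obtain rfl : d = 0 := Finsupp.ext fun i => hd0 i (Set.mem_univ i)
  exact mem_support_iff.1 hd

lemma mem_maxIdeal_of_mul_mem {K : Ideal (MvPolynomial σ k)}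
    (hK : K.IsHomogeneous (homogeneousSubmodule σ k)) {d : ℕ} {r z : MvPolynomial σ k}
    (hz : z ∈ homogeneousSubmodule σ k d) (hzK : z ∉ K) (h : r * z ∈ K) : r ∈ maxIdeal k σ := by
  by_contra hr
  have hc := coeff_zero_ne_zero_of_notMem_maxIdeal hr
  have h1 := (Ideal.IsHomogeneous.mem_iff _ hK).1 h d
  rw [DirectSum.coe_decompose_mul_of_right_mem_of_le _ hz le_rfl, Nat.sub_self,
    show (DirectSum.decompose (homogeneousSubmodule σ k) r 0 : MvPolynomial σ k) =
      homogeneousComponent 0 r from decomposition.decompose'_apply r 0,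
    homogeneousComponent_zero] at h1
  have h2 := K.mul_mem_left (C (coeff 0 r)⁻¹) h1
  rw [← mul_assoc, ← C_mul, inv_mul_cancel₀ hc, C_1, one_mul] at h2
  exact hzK h2

lemma isHomogeneous_comap {I : Ideal (MvPolynomial σ k)}
    (hI : I.IsHomogeneous (homogeneousSubmodule σ k))
    {N : Submodule (MvPolynomial σ k) (MvPolynomial σ k ⧸ I)} (hN : IsGradedSubmodule k σ I N) :
    Ideal.IsHomogeneous (homogeneousSubmodule σ k) (N.comap I.mkQ) := by
  obtain ⟨K, hK, hNK⟩ := hN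
  have : N = Submodule.map I.mkQ K := by
    ext x
    rw [hNK, Ideal.mem_map_iff_of_surjective _ Ideal.Quotient.mk_surjective]
    rfl
  rw [this, Submodule.comap_map_mkQ]
  exact hI.sup hK

end HomogeneousColon

section Necessity

attribute [local instance] MvPolynomial.gradedAlgebra

variable {k : Type} [Field k] {n : ℕ} {lam : ℕ → ℕ}

lemma cornerInf_dimIndices_le (hlam : Antitone lam) {L : ℕ}
    {K : Ideal (MvPolynomial (Fin n ⊕ Fin (lam 0)) k)}
    (hI : cornerInf k n (lam 0) lam (Finset.range (n + 1)) ≤ K)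
    (hK : K.IsHomogeneous (homogeneousSubmodule _ k))
    (hdepth : DepthGE (maxIdeal k (Fin n ⊕ Fin (lam 0))) L (MvPolynomial _ k ⧸ K)) :
    cornerInf k n (lam 0) lam (dimIndices n lam L) ≤ K := by
  by_contra hle
  obtain ⟨f, hf, hfK⟩ := SetLike.not_le_iff_exists.1 hle
  rw [Ideal.IsHomogeneous.mem_iff _ hK] at hfK
  push Not at hfK
  obtain ⟨d, hzK⟩ := hfK
  have hzA := (Ideal.IsHomogeneous.mem_iff _ (isHomogeneous_cornerInf lam _)).1 hf d
  have hzd := SetLike.coe_mem (DirectSum.decompose (homogeneousSubmodule _ k) f d)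
  generalize (DirectSum.decompose (homogeneousSubmodule _ k) f d :
    MvPolynomial (Fin n ⊕ Fin (lam 0)) k) = z at hzK hzA hzd
  obtain ⟨p, hp, hpz, hdim⟩ := hdepth.exists_prime (Ideal.Quotient.mk K z) fun r hr =>
    mem_maxIdeal_of_mul_mem hK hzd hzK (smul_quotientMk_eq_zero_iff.1 hr)
  have hprod : ∏ a ∈ Finset.range (n + 1) \ dimIndices n lam L, cornerIdeal k n (lam 0) a (lam a)
      ≤ p := fun r hr => by
    refine hpz r (smul_quotientMk_eq_zero_iff.2 (hI (mem_cornerInf.2 fun a ha => ?_)))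
    by_cases ha' : a ∈ dimIndices n lam L
    · exact Ideal.mul_mem_left _ _ (mem_cornerInf.1 hzA a ha')
    · exact Ideal.mul_mem_right _ _ (mem_cornerInf.1 (prod_cornerIdeal_le _ hr) a
        (Finset.mem_sdiff.2 ⟨ha, ha'⟩))
  obtain ⟨a, ha, hap⟩ := hp.prod_le.1 hprod
  rw [Finset.mem_sdiff, Finset.mem_range, mem_dimIndices] at ha
  have hdim' := hdim.trans (ringKrullDim_le_of_surjective (Ideal.Quotient.factor hap)
    (Ideal.Quotient.factor_surjective _))
  rw [ringKrullDim_quotient_cornerIdeal (by lia) (hlam a.zero_le)] at hdim'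
  have : L ≤ n + lam 0 - (a + lam a) := by exact_mod_cast hdim'
  have := hlam a.zero_le
  exact ha.2 ⟨by lia, by lia⟩

lemma le_of_strict_steps {α : Type*} [Preorder α] {r : ℕ} {f : ℕ → α}
    (h : ∀ i, i + 2 ≤ r → f i < f (i + 1)) {i j : ℕ} (hij : i ≤ j) (hj : j < r) : f i ≤ f j := by
  induction j, hij using Nat.le_induction with
  | base => exact le_rfl
  | succ j hij ih => exact (ih (by lia)).trans (h j hj).le

lemma smallGaps_of_isSCMIdeal (hlam : Antitone lam)
    (h : IsSCMIdeal k (Fin n ⊕ Fin (lam 0)) (cornerInf k n (lam 0) lam (Finset.range (n + 1)))) :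
    SmallGaps n lam := by
  have hIhom := isHomogeneous_cornerInf (k := k) (n := n) (m := lam 0) lam (Finset.range (n + 1))
  have hIQ : ∀ a ≤ n, cornerInf k n (lam 0) lam (Finset.range (n + 1)) ≤
      cornerIdeal k n (lam 0) a (lam a) := fun a ha =>
    cornerInf_le (Finset.mem_range.2 (by lia))
  have hIK : ∀ K, cornerInf k n (lam 0) lam (Finset.range (n + 1)) ≤ K →
      K.IsHomogeneous (homogeneousSubmodule _ k) → ∀ L,
      DepthGE (maxIdeal k (Fin n ⊕ Fin (lam 0))) L (MvPolynomial _ k ⧸ K) →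
      cornerInf k n (lam 0) lam (dimIndices n lam L) ≤ K := fun K hI hK L hd =>
    cornerInf_dimIndices_le hlam hI hK hd
  generalize cornerInf k n (lam 0) lam (Finset.range (n + 1)) = I at h hIhom hIQ hIK
  obtain ⟨r, M, h0, hr, hlt, hgr, hcm, hinc⟩ := h
  let dimC : ℕ → WithBot ℕ∞ := fun i =>
    moduleDim (MvPolynomial (Fin n ⊕ Fin (lam 0)) k) (StepQuot (M i) (M (i + 1)))
  refine smallGaps_of_depthGE (k := k) hlam fun L => ?_
  classical
  have hex : ∃ i, i ≤ r ∧ ∀ j, i ≤ j → j < r → L ≤ dimC j := ⟨r, le_rfl, fun j hj hj' => by lia⟩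
  obtain ⟨i, ⟨hir, hi⟩, hmin⟩ : ∃ i, (i ≤ r ∧ ∀ j, i ≤ j → j < r → L ≤ dimC j) ∧
      ∀ i' < i, ¬ (i' ≤ r ∧ ∀ j, i' ≤ j → j < r → L ≤ dimC j) :=
    ⟨Nat.find hex, Nat.find_spec hex, fun i' => Nat.find_min hex⟩
  have hsmall : ∀ j < i, dimC j < L := by
    intro j hj
    obtain ⟨i', rfl⟩ : ∃ i', i = i' + 1 := ⟨i - 1, by lia⟩
    have h1 := hmin i' (by lia)
    push Not at h1
    obtain ⟨j', hj'1, hj'2, hj'3⟩ := h1 (by lia)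
    obtain rfl : j' = i' := by
      by_contra hne
      exact absurd (hi j' (by lia) hj'2) (not_le.2 hj'3)
    exact (le_of_strict_steps (f := dimC) hinc (by lia) hj'2).trans_lt hj'3
  have hdepth : DepthGE (maxIdeal k (Fin n ⊕ Fin (lam 0))) L
      (MvPolynomial _ k ⧸ (M i).comap I.mkQ) := by
    refine DepthGE.quotient_comap ?_
    suffices ∀ j ≤ r, i ≤ j → DepthGE (maxIdeal k (Fin n ⊕ Fin (lam 0))) L
        ((MvPolynomial _ k ⧸ I) ⧸ M j) from this i hir le_rfl
    intro j hj
    induction hj using Nat.decreasingInduction with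
    | self =>
      intro _
      rw [hr]
      exact DepthGE.of_subsingleton L
    | of_succ j hj ih =>
      intro hij
      exact DepthGE.quotient_of_stepQuot (hlt j hj).le
        (fun t ht => hcm j hj t (lt_of_lt_of_le (by exact_mod_cast ht) (hi j hij hj)))
        (ih (by lia))
  have hle : (M i).comap I.mkQ ≤ cornerInf k n (lam 0) lam (dimIndices n lam L) := by
    intro f hf
    refine mem_cornerInf.2 fun a ha => ?_
    have ha' := mem_dimIndices.1 ha
    suffices ∀ j ≤ i, (M j).comap I.mkQ ≤ cornerIdeal k n (lam 0) a (lam a) from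
      this i le_rfl hf
    intro j
    induction j with
    | zero =>
      intro _
      rw [h0, ← LinearMap.ker, Submodule.ker_mkQ]
      exact hIQ a ha'.1
    | succ j ih =>
      intro hj f hf
      by_contra hfa
      have hann : Module.annihilator _ (StepQuot (M j) (M (j + 1))) ≤
          cornerIdeal k n (lam 0) a (lam a) := fun s hs => by
        have h := mem_annihilator_stepQuot.1 hs _ (Submodule.mem_comap.1 hf)
        rw [← map_smul, ← Submodule.mem_comap, smul_eq_mul] at h
        exact (Ideal.IsPrime.mem_or_mem inferInstance (ih (by lia) h)).resolve_right hfa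
      exact absurd (hsmall j hj) (not_lt.2
        ((le_ringKrullDim_quotient_cornerIdeal ha'.1 (hlam a.zero_le) ha'.2).trans
          (ringKrullDim_le_of_surjective (Ideal.Quotient.factor hann)
            (Ideal.Quotient.factor_surjective _))))
  have hIM : I ≤ (M i).comap I.mkQ := fun f hf => by
    rw [Submodule.mem_comap, Submodule.mkQ_apply, (Submodule.Quotient.mk_eq_zero _).2 hf]
    exact (M i).zero_mem
  have heq := le_antisymm hle (hIK _ hIM (isHomogeneous_comap hIhom (hgr i hir)) L hdepth)
  rw [← heq]
  exact hdepth

end Necessity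

/-- Let `λ` be a partition. The Ferrers ideal `I_λ` is sequentially
Cohen-Macaulay if and only if `λ` is saturated. -/
theorem stmt_0 (k : Type) [Field k] (n : ℕ) (lam : ℕ → ℕ)
    (hpart : IsPartitionFn n lam) :
    IsSCMIdeal k (Fin n ⊕ Fin (lam 0)) (skewIdeal k n lam fun _ => 0) ↔
      IsSaturated n lam := by
  rw [skewIdeal_eq_cornerInf hpart]
  exact ⟨fun h => (smallGaps_of_isSCMIdeal hpart.2.1 h).isSaturated hpart,
    fun h => isSCMIdeal_cornerInf hpart.2.1 (h.smallGaps hpart.2.1)⟩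

end SkewTab
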